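/- arXiv:2304.14112 — 2 statements merged into one kernel-verified Lean document; each statement's English description precedes it below -/
import Mathlib

section
/- Let n ≥ 2, k ≥ 1, ℓ ∈ {0, …, k−1} with k − ℓ < n, and let A(D) be a homogeneous linear differential operator of order k on ℝⁿ from V to E which is injectively elliptic. If there exists a constant C ∈ (0,∞) such that for every u ∈ C^∞_c(ℝⁿ, V) one has (∫_{ℝⁿ} |D^ℓ u|^{n/(n−(k−ℓ))})^{1 − (k−ℓ)/n} ≤ C ∫_{ℝⁿ} |A(D)u|, then A(D) is cancelling. -/
open MeasureTheory

noncomputable section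

/-- First-order partial derivative in the `i`-th coordinate direction. -/
def pd {n : ℕ} {V : Type*} [NormedAddCommGroup V] [NormedSpace ℝ V] (i : Fin n)
    (u : EuclideanSpace ℝ (Fin n) → V) : EuclideanSpace ℝ (Fin n) → V :=
  fun x => fderiv ℝ u x (EuclideanSpace.single i 1)

/-- Iterated partial derivative `∂^α`. -/
def pdMulti {n : ℕ} {V : Type*} [NormedAddCommGroup V] [NormedSpace ℝ V] (α : Fin n → ℕ)
    (u : EuclideanSpace ℝ (Fin n) → V) : EuclideanSpace ℝ (Fin n) → V :=
  (List.finRange n).foldr (fun i v => (pd i)^[α i] v) u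

/-- The homogeneous differential operator `A(D) = ∑_{|α|=k} A_α ∂^α` applied to `u`. -/
def opApply {n : ℕ} {V E : Type*} [NormedAddCommGroup V] [NormedSpace ℝ V]
    [NormedAddCommGroup E] [NormedSpace ℝ E]
    (k : ℕ) (A : (Fin n → ℕ) → (V →ₗ[ℝ] E))
    (u : EuclideanSpace ℝ (Fin n) → V) : EuclideanSpace ℝ (Fin n) → E :=
  fun x => ∑ α ∈ Finset.Nat.antidiagonalTuple n k, A α (pdMulti α u x)

/-- The symbol `A(ξ) = ∑_{|α|=k} ξ^α A_α` of the operator. -/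
def symb {n : ℕ} {V E : Type*} [NormedAddCommGroup V] [NormedSpace ℝ V]
    [NormedAddCommGroup E] [NormedSpace ℝ E]
    (k : ℕ) (A : (Fin n → ℕ) → (V →ₗ[ℝ] E)) (ξ : EuclideanSpace ℝ (Fin n)) :
    V →ₗ[ℝ] E :=
  ∑ α ∈ Finset.Nat.antidiagonalTuple n k, (∏ i, ξ i ^ α i) • A α


open Filter Topology

section L1
variable {n : ℕ} {V E : Type*} [NormedAddCommGroup V] [NormedSpace ℝ V]
    [NormedAddCommGroup E] [NormedSpace ℝ E]

theorem pd_contDiff (i : Fin n) {u : EuclideanSpace ℝ (Fin n) → V}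
    (hu : ContDiff ℝ (⊤ : ℕ∞) u) : ContDiff ℝ (⊤ : ℕ∞) (pd i u) := by
  unfold pd
  exact (hu.fderiv_right (m := (⊤ : ℕ∞)) (by simp)).clm_apply contDiff_const

theorem pd_bound (i : Fin n) {u : EuclideanSpace ℝ (Fin n) → V}
    (hu : ContDiff ℝ (⊤ : ℕ∞) u) (j : ℕ) (x : EuclideanSpace ℝ (Fin n)) :
    ‖iteratedFDeriv ℝ j (pd i u) x‖ ≤ ‖iteratedFDeriv ℝ (j + 1) u x‖ := by
  unfold pd
  have h := norm_iteratedFDeriv_clm_apply_const (𝕜 := ℝ) (f := fderiv ℝ u)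
    (c := EuclideanSpace.single i (1 : ℝ)) (x := x) (N := (⊤ : ℕ∞)) (n := j)
    (hu.fderiv_right (m := (⊤ : ℕ∞)) (by simp)).contDiffAt (mod_cast le_top)
  rw [norm_iteratedFDeriv_fderiv] at h
  simpa using h

theorem pdIter (i : Fin n) (m : ℕ) {u : EuclideanSpace ℝ (Fin n) → V}
    (hu : ContDiff ℝ (⊤ : ℕ∞) u) : ContDiff ℝ (⊤ : ℕ∞) ((pd i)^[m] u) ∧
    ∀ j x, ‖iteratedFDeriv ℝ j ((pd i)^[m] u) x‖ ≤ ‖iteratedFDeriv ℝ (j + m) u x‖ := by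
  induction m generalizing u with
  | zero => exact ⟨hu, fun j x => le_rfl⟩
  | succ m ih =>
    rw [Function.iterate_succ_apply]
    obtain ⟨h1, h2⟩ := ih (pd_contDiff i hu)
    refine ⟨h1, fun j x => (h2 j x).trans ?_⟩
    exact pd_bound i hu (j + m) x

theorem pdFold (α : Fin n → ℕ) {u : EuclideanSpace ℝ (Fin n) → V}
    (hu : ContDiff ℝ (⊤ : ℕ∞) u) (l : List (Fin n)) :
    ContDiff ℝ (⊤ : ℕ∞) (l.foldr (fun i v => (pd i)^[α i] v) u) ∧
    ∀ j x, ‖iteratedFDeriv ℝ j (l.foldr (fun i v => (pd i)^[α i] v) u) x‖ ≤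
      ‖iteratedFDeriv ℝ (j + (l.map α).sum) u x‖ := by
  induction l with
  | nil => exact ⟨hu, fun j x => le_rfl⟩
  | cons i l ih =>
    obtain ⟨h1, h2⟩ := ih
    obtain ⟨h3, h4⟩ := pdIter i (α i) h1
    refine ⟨h3, fun j x => (h4 j x).trans ((h2 _ x).trans ?_)⟩
    rw [List.map_cons, List.sum_cons, ← add_assoc]

theorem pdMulti_contDiff (α : Fin n → ℕ) {u : EuclideanSpace ℝ (Fin n) → V}
    (hu : ContDiff ℝ (⊤ : ℕ∞) u) : ContDiff ℝ (⊤ : ℕ∞) (pdMulti α u) :=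
  (pdFold α hu _).1

theorem sum_finRange (α : Fin n → ℕ) : ((List.finRange n).map α).sum = ∑ i, α i := by
  simp [Fin.sum_univ_def]

theorem pdMulti_bound (α : Fin n → ℕ) {u : EuclideanSpace ℝ (Fin n) → V}
    (hu : ContDiff ℝ (⊤ : ℕ∞) u) (x : EuclideanSpace ℝ (Fin n)) :
    ‖pdMulti α u x‖ ≤ ‖iteratedFDeriv ℝ (∑ i, α i) u x‖ := by
  have := (pdFold α hu (List.finRange n)).2 0 x
  rw [norm_iteratedFDeriv_zero, zero_add, sum_finRange] at this
  exact this

theorem pd_congr (i : Fin n) {u v : EuclideanSpace ℝ (Fin n) → V} {x : EuclideanSpace ℝ (Fin n)}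
    (h : u =ᶠ[𝓝 x] v) : pd i u =ᶠ[𝓝 x] pd i v := by
  unfold pd
  filter_upwards [h.fderiv (𝕜 := ℝ)] with y hy
  rw [hy]

theorem pdMulti_congr (α : Fin n → ℕ) {u v : EuclideanSpace ℝ (Fin n) → V}
    {x : EuclideanSpace ℝ (Fin n)}
    (h : u =ᶠ[𝓝 x] v) : pdMulti α u =ᶠ[𝓝 x] pdMulti α v := by
  unfold pdMulti
  induction (List.finRange n) with
  | nil => exact h
  | cons i l ih =>
    simp only [List.foldr_cons]
    induction α i with
    | zero => exact ih
    | succ m ih2 =>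
      rw [Function.iterate_succ_apply', Function.iterate_succ_apply']
      exact pd_congr i ih2

theorem opApply_congr (k : ℕ) (A : (Fin n → ℕ) → (V →ₗ[ℝ] E)) 
    {u v : EuclideanSpace ℝ (Fin n) → V} {x : EuclideanSpace ℝ (Fin n)}
    (h : u =ᶠ[𝓝 x] v) : opApply k A u x = opApply k A v x := by
  unfold opApply
  exact Finset.sum_congr rfl fun α _ => by rw [(pdMulti_congr α h).eq_of_nhds]

theorem opApply_continuous [FiniteDimensional ℝ V] (k : ℕ) (A : (Fin n → ℕ) → (V →ₗ[ℝ] E))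
    {u : EuclideanSpace ℝ (Fin n) → V} (hu : ContDiff ℝ (⊤ : ℕ∞) u) :
    Continuous (opApply k A u) := by
  unfold opApply
  exact continuous_finsetSum _ fun α _ =>
    (A α).continuous_of_finiteDimensional.comp (pdMulti_contDiff α hu).continuous

theorem opApply_bound [FiniteDimensional ℝ V] (k : ℕ) (A : (Fin n → ℕ) → (V →ₗ[ℝ] E)) :
    ∃ M : ℝ, 0 ≤ M ∧ ∀ u : EuclideanSpace ℝ (Fin n) → V, ContDiff ℝ (⊤ : ℕ∞) u → ∀ x,
      ‖opApply k A u x‖ ≤ M * ‖iteratedFDeriv ℝ k u x‖ := by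
  refine ⟨∑ α ∈ Finset.Nat.antidiagonalTuple n k, ‖LinearMap.toContinuousLinearMap (A α)‖,
    Finset.sum_nonneg fun _ _ => norm_nonneg _, fun u hu x => ?_⟩
  unfold opApply
  rw [Finset.sum_mul]
  refine (norm_sum_le _ _).trans (Finset.sum_le_sum fun α hα => ?_)
  have h1 := (LinearMap.toContinuousLinearMap (A α)).le_opNorm (pdMulti α u x)
  refine h1.trans ?_
  gcongr
  have := pdMulti_bound α hu x
  rwa [Finset.Nat.mem_antidiagonalTuple.mp hα] at this

/-- The estimate passes from test functions to Schwartz functions. -/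
theorem est_schwartz [FiniteDimensional ℝ V] (k ℓ : ℕ)
    (A : (Fin n → ℕ) → (V →ₗ[ℝ] E)) (p r C : ℝ) (hp : 0 < p) (hr : r = p⁻¹)
    (hest : ∀ u : EuclideanSpace ℝ (Fin n) → V,
      ContDiff ℝ (⊤ : ℕ∞) u → HasCompactSupport u →
      (∫ x, ‖iteratedFDeriv ℝ ℓ u x‖ ^ p) ^ r ≤ C * ∫ x, ‖opApply k A u x‖)
    (u : SchwartzMap (EuclideanSpace ℝ (Fin n)) V) :
    ∫⁻ x, ENNReal.ofReal (‖iteratedFDeriv ℝ ℓ u x‖ ^ p) ≤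
      ENNReal.ofReal ((C * ∫ x, ‖opApply k A u x‖) ^ p) := by
  subst hr
  let χ : ContDiffBump (0 : EuclideanSpace ℝ (Fin n)) := ⟨1, 2, one_pos, one_lt_two⟩
  have hχ : ContDiff ℝ (⊤ : ℕ∞) χ := χ.contDiff
  let χS := χ.hasCompactSupport.toSchwartzMap hχ
  let c : ℕ → ℝ := fun j => ((j : ℝ) + 1)⁻¹
  have hc0 : ∀ j, 0 < c j := fun j => by positivity
  have hc1 : ∀ j, c j ≤ 1 := fun j => inv_le_one_of_one_le₀ (by simp)
  have hclim : Tendsto c atTop (𝓝 0) := by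
    simpa [c, one_div] using tendsto_one_div_add_atTop_nhds_zero_nat (𝕜 := ℝ)
  let v : ℕ → EuclideanSpace ℝ (Fin n) → V := fun j x => χ (c j • x) • u x
  have hu : ContDiff ℝ (⊤ : ℕ∞) u := u.smooth _
  have hχc : ∀ j, ContDiff ℝ (⊤ : ℕ∞) (fun x => χ (c j • x)) := fun j =>
    hχ.comp (contDiff_const_smul _)
  have hv : ∀ j, ContDiff ℝ (⊤ : ℕ∞) (v j) := fun j => (hχc j).smul hu
  have hvs : ∀ j, HasCompactSupport (v j) := fun j => by
    have : HasCompactSupport (fun x => χ (c j • x)) :=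
      χ.hasCompactSupport.comp_smul (hc0 j).ne'
    exact this.smul_right
  have hloc : ∀ x, ∀ᶠ j in atTop, v j =ᶠ[𝓝 x] u := by
    intro x
    have : Tendsto (fun j => c j * (‖x‖ + 1)) atTop (𝓝 (0 * (‖x‖ + 1))) := hclim.mul_const _
    rw [zero_mul] at this
    filter_upwards [this.eventually_lt_const one_pos] with j hj
    filter_upwards [Metric.ball_mem_nhds x one_pos] with y hy
    have hy2 : ‖y‖ ≤ ‖x‖ + 1 := by
      have := norm_le_norm_add_norm_sub' y x
      rw [Metric.mem_ball, dist_eq_norm] at hy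
      linarith
    have : χ (c j • y) = 1 := by
      apply χ.one_of_mem_closedBall
      rw [mem_closedBall_zero_iff, norm_smul, Real.norm_of_nonneg (hc0 j).le]
      exact (mul_le_mul_of_nonneg_left hy2 (hc0 j).le).trans hj.le
    simp [v, this]
  -- domination
  obtain ⟨M, hM0, hM⟩ := opApply_bound (n := n) k A
  let b : EuclideanSpace ℝ (Fin n) → ℝ := fun x => M * ∑ i ∈ Finset.range (k + 1),
    (k.choose i : ℝ) * SchwartzMap.seminorm ℝ 0 i χS * ‖iteratedFDeriv ℝ (k - i) u x‖
  have hb : ∀ j x, ‖opApply k A (v j) x‖ ≤ b x := by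
    intro j x
    refine (hM _ (hv j) x).trans ?_
    simp only [b]
    gcongr
    refine (norm_iteratedFDeriv_smul_le (N := (⊤ : ℕ∞)) (hχc j) hu x (n := k) (mod_cast le_top)).trans ?_
    gcongr with i hi
    rw [iteratedFDeriv_comp_const_smul (c j) (hχ.of_le (mod_cast le_top)), norm_smul]
    have h1 : ‖iteratedFDeriv ℝ i χ (c j • x)‖ ≤ SchwartzMap.seminorm ℝ 0 i χS :=
      SchwartzMap.norm_iteratedFDeriv_le_seminorm ℝ χS i _
    have h2 : ‖c j ^ i‖ ≤ 1 := by
      rw [norm_pow, Real.norm_of_nonneg (hc0 j).le]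
      exact pow_le_one₀ (hc0 j).le (hc1 j)
    calc _ ≤ 1 * ‖iteratedFDeriv ℝ i χ (c j • x)‖ := by gcongr
      _ ≤ _ := by simpa using h1
  have hbi : Integrable b := by
    refine Integrable.const_mul (integrable_finsetSum _ fun i _ => Integrable.const_mul ?_ _) _
    simpa using u.integrable_pow_mul_iteratedFDeriv volume 0 (k - i)
  have hlimR : Tendsto (fun j => ∫ x, ‖opApply k A (v j) x‖) atTop
      (𝓝 (∫ x, ‖opApply k A u x‖)) := by
    refine tendsto_integral_of_dominated_convergence b
      (fun j => (opApply_continuous k A (hv j)).norm.aestronglyMeasurable) hbi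
      (fun j => ae_of_all _ fun x => by simpa using hb j x) (ae_of_all _ fun x => ?_)
    refine tendsto_const_nhds.congr' ?_
    filter_upwards [hloc x] with j hj
    rw [opApply_congr k A hj]
  have hcontL : ∀ w : EuclideanSpace ℝ (Fin n) → V, ContDiff ℝ (⊤ : ℕ∞) w →
      Continuous (fun x => ‖iteratedFDeriv ℝ ℓ w x‖ ^ p) := fun w hw =>
    ((hw.continuous_iteratedFDeriv (mod_cast le_top)).norm).rpow_const fun _ => Or.inr hp.le
  have hj : ∀ j, ∫⁻ x, ENNReal.ofReal (‖iteratedFDeriv ℝ ℓ (v j) x‖ ^ p) ≤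
      ENNReal.ofReal ((C * ∫ x, ‖opApply k A (v j) x‖) ^ p) := by
    intro j
    have h0 : ∀ x, 0 ≤ ‖iteratedFDeriv ℝ ℓ (v j) x‖ ^ p := fun x => by positivity
    rw [← ofReal_integral_eq_lintegral_ofReal _ (ae_of_all _ h0)]
    · apply ENNReal.ofReal_le_ofReal
      have h1 := hest (v j) (hv j) (hvs j)
      have h2 : 0 ≤ ∫ x, ‖iteratedFDeriv ℝ ℓ (v j) x‖ ^ p := integral_nonneg h0
      have h3 := Real.rpow_le_rpow (by positivity) h1 hp.le
      rwa [← Real.rpow_mul h2, inv_mul_cancel₀ hp.ne', Real.rpow_one] at h3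
    · refine (hcontL _ (hv j)).integrable_of_hasCompactSupport ?_
      exact ((hvs j).iteratedFDeriv ℓ).comp_left (g := fun z => ‖z‖ ^ p)
        (by simp [Real.zero_rpow hp.ne'])
  have hlim2 : Tendsto (fun j => ENNReal.ofReal ((C * ∫ x, ‖opApply k A (v j) x‖) ^ p)) atTop
      (𝓝 (ENNReal.ofReal ((C * ∫ x, ‖opApply k A u x‖) ^ p))) :=
    (ENNReal.continuous_ofReal.tendsto _).comp
      (((Real.continuous_rpow_const hp.le).tendsto _).comp (hlimR.const_mul C))
  calc ∫⁻ x, ENNReal.ofReal (‖iteratedFDeriv ℝ ℓ u x‖ ^ p)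
      = ∫⁻ x, liminf (fun j => ENNReal.ofReal (‖iteratedFDeriv ℝ ℓ (v j) x‖ ^ p)) atTop := by
        congr 1
        ext x
        refine (Tendsto.liminf_eq ?_).symm
        refine tendsto_const_nhds.congr' ?_
        filter_upwards [hloc x] with j hj
        rw [(hj.iteratedFDeriv ℝ ℓ).eq_of_nhds]
    _ ≤ liminf (fun j => ∫⁻ x, ENNReal.ofReal (‖iteratedFDeriv ℝ ℓ (v j) x‖ ^ p)) atTop :=
        lintegral_liminf_le fun j => (hcontL _ (hv j)).measurable.ennreal_ofReal
    _ ≤ liminf (fun j => ENNReal.ofReal ((C * ∫ x, ‖opApply k A (v j) x‖) ^ p)) atTop :=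
        liminf_le_liminf (Eventually.of_forall hj)
    _ = _ := hlim2.liminf_eq
end L1

section L2
open scoped ENNReal

/-- Core dilation argument. -/
theorem core_dilation {n : ℕ} (s p q : ℝ) (hpq : p.HolderConjugate q) (hn : 0 < n)
    (hs : (n - s) * p = n)
    (h : EuclideanSpace ℝ (Fin n) → ℂ) (hh : Measurable h)
    (hhq : ∫⁻ x, ‖h x‖ₑ ^ q ≠ ∞) (K : ℝ≥0∞) (hK : K ≠ ∞) (c₀ : ℝ≥0∞) (hc₀ : c₀ ≠ 0)
    (hc₀' : c₀ ≠ ∞)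
    (H : ∀ Λ : ℝ, 1 ≤ Λ → ∃ G : EuclideanSpace ℝ (Fin n) → ℂ, Measurable G ∧
      ∫⁻ x, ‖G x‖ₑ ^ p ≤ K ∧
      ∀ t : ℝ, 1 ≤ t → t ≤ Λ → 
        c₀ ≤ ∫⁻ x, ‖(t ^ (s - n) : ℝ) • G (t⁻¹ • x)‖ₑ * ‖h x‖ₑ) : False := by
  have hp0 : 0 < p := hpq.pos
  have hq0 : 0 < q := hpq.symm.pos
  -- scaling of the integrals
  have scal : ∀ (G : EuclideanSpace ℝ (Fin n) → ℂ), Measurable G → ∀ t : ℝ, 1 ≤ t →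
      ∀ B : Set (EuclideanSpace ℝ (Fin n)), MeasurableSet B →
      ∫⁻ x in B, ‖(t ^ (s - n) : ℝ) • G (t⁻¹ • x)‖ₑ ^ p =
        ∫⁻ x in (fun x => t • x) ⁻¹' B, ‖G x‖ₑ ^ p := by
    intro G hG t ht B hB
    have t0 : 0 < t := by linarith
    rw [← lintegral_indicator hB, ← lintegral_indicator (hB.preimage (measurable_const_smul t))]
    have hmap := Measure.map_addHaar_smul (volume : Measure (EuclideanSpace ℝ (Fin n))) t0.ne'
    have e1 : ∫⁻ x, ((fun x => t • x) ⁻¹' B).indicator (fun x => ‖G x‖ₑ ^ p) x =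
        ∫⁻ y, B.indicator (fun y => ‖G (t⁻¹ • y)‖ₑ ^ p) y
          ∂(Measure.map (fun x => t • x) volume) := by
      rw [lintegral_map _ (measurable_const_smul t)]
      · congr 1
        ext x
        by_cases hx : t • x ∈ B
        · rw [Set.indicator_of_mem hx, Set.indicator_of_mem (by exact hx), smul_smul,
            inv_mul_cancel₀ t0.ne', one_smul]
        · rw [Set.indicator_of_notMem hx, Set.indicator_of_notMem (by exact hx)]
      · exact (((hG.comp (measurable_const_smul _)).enorm).pow_const p).indicator hB
    rw [e1, hmap, lintegral_smul_measure, smul_eq_mul, ← lintegral_const_mul]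
    · congr 1
      ext x
      by_cases hx : x ∈ B
      · rw [Set.indicator_of_mem hx, Set.indicator_of_mem hx, enorm_smul,
          ENNReal.mul_rpow_of_nonneg _ _ hp0.le]
        congr 1
        rw [Real.enorm_of_nonneg (by positivity), ENNReal.ofReal_rpow_of_nonneg (by positivity) hp0.le,
          ← Real.rpow_mul t0.le, finrank_euclideanSpace, Fintype.card_fin, abs_of_nonneg (by positivity),
          ← Real.rpow_natCast, ← Real.rpow_neg t0.le]
        congr 2
        linarith
      · rw [Set.indicator_of_notMem hx, Set.indicator_of_notMem hx, mul_zero]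
    · exact (((hG.comp (measurable_const_smul _)).enorm).pow_const p).indicator hB
  -- choose annulus
  let B : ℕ → Set (EuclideanSpace ℝ (Fin n)) := fun i =>
    {x | ((i : ℝ) + 1)⁻¹ < ‖x‖ ∧ ‖x‖ ≤ (i : ℝ) + 1}
  have hBm : ∀ i, MeasurableSet (B i) := fun i =>
    (measurableSet_lt measurable_const measurable_norm).inter
      (measurableSet_le measurable_norm measurable_const)
  have hBlim : Tendsto (fun i => ∫⁻ x in (B i)ᶜ, ‖h x‖ₑ ^ q) atTop (𝓝 0) := by
    have e : ∀ i, ∫⁻ x in (B i)ᶜ, ‖h x‖ₑ ^ q =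
        ∫⁻ x, (B i)ᶜ.indicator (fun x => ‖h x‖ₑ ^ q) x := fun i =>
      (lintegral_indicator (hBm i).compl _).symm
    simp_rw [e]
    have : (0 : ℝ≥0∞) = ∫⁻ x : EuclideanSpace ℝ (Fin n), 0 := by simp
    rw [this]
    refine tendsto_lintegral_of_dominated_convergence (fun x => ‖h x‖ₑ ^ q)
      (fun i => (hh.enorm.pow_const q).indicator (hBm i).compl)
      (fun i => ae_of_all _ fun x => Set.indicator_le_self _ _ x) hhq ?_
    have : Nonempty (Fin n) := ⟨⟨0, hn⟩⟩
    have hne : ∀ᵐ x : EuclideanSpace ℝ (Fin n), x ≠ 0 := by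
      simp [ae_iff]
    filter_upwards [hne] with x hx
    refine tendsto_const_nhds.congr' ?_
    have hx' : 0 < ‖x‖ := norm_pos_iff.mpr hx
    have l1 : Tendsto (fun i : ℕ => ((i : ℝ) + 1)⁻¹) atTop (𝓝 0) := by
      simpa [one_div] using tendsto_one_div_add_atTop_nhds_zero_nat (𝕜 := ℝ)
    have l2 : Tendsto (fun i : ℕ => (i : ℝ) + 1) atTop atTop :=
      tendsto_atTop_add_const_right _ _ tendsto_natCast_atTop_atTop
    filter_upwards [l1.eventually_lt_const hx', l2.eventually_ge_atTop ‖x‖] with i h1 h2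
    rw [Set.indicator_of_notMem]
    simp only [Set.mem_compl_iff, not_not]
    exact ⟨h1, h2⟩
  have hlim2 : Tendsto (fun i => K ^ (1 / p) * (∫⁻ x in (B i)ᶜ, ‖h x‖ₑ ^ q) ^ (1 / q)) atTop
      (𝓝 0) := by
    have h1 : Tendsto (fun i => (∫⁻ x in (B i)ᶜ, ‖h x‖ₑ ^ q) ^ (1 / q)) atTop (𝓝 0) := by
      have := (ENNReal.continuous_rpow_const (y := 1 / q)).tendsto 0 |>.comp hBlim
      rwa [ENNReal.zero_rpow_of_pos (by positivity)] at this
    have := ENNReal.Tendsto.const_mul (a := K ^ (1 / p)) h1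
      (Or.inr (ENNReal.rpow_ne_top_of_nonneg (by positivity) hK))
    rwa [mul_zero] at this
  have hc2 : 0 < c₀ / 2 := ENNReal.half_pos hc₀
  obtain ⟨i, hi⟩ := (hlim2.eventually_lt_const hc2).exists
  set ρ : ℝ := (i : ℝ) + 1 with hρ
  have hρ1 : 1 ≤ ρ := by simp [hρ]
  set Q : ℝ≥0∞ := (∫⁻ x, ‖h x‖ₑ ^ q) ^ (1 / q) with hQ
  have hQt : Q ≠ ∞ := ENNReal.rpow_ne_top_of_nonneg (by positivity) hhq
  -- lower bound on each annulus
  have low : ∀ F : EuclideanSpace ℝ (Fin n) → ℂ, Measurable F → ∫⁻ x, ‖F x‖ₑ ^ p ≤ K →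
      c₀ ≤ ∫⁻ x, ‖F x‖ₑ * ‖h x‖ₑ →
      c₀ / 2 ≤ (∫⁻ x in B i, ‖F x‖ₑ ^ p) ^ (1 / p) * Q := by
    intro F hF hFK hFc
    rw [← lintegral_add_compl _ (hBm i)] at hFc
    have a1 := ENNReal.lintegral_mul_le_Lp_mul_Lq (volume.restrict (B i)) hpq
      hF.enorm.aemeasurable hh.enorm.aemeasurable
    have a2 := ENNReal.lintegral_mul_le_Lp_mul_Lq (volume.restrict (B i)ᶜ) hpq
      hF.enorm.aemeasurable hh.enorm.aemeasurable
    simp only [Pi.mul_apply] at a1 a2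
    have a3 : (∫⁻ x in B i, ‖h x‖ₑ ^ q) ^ (1 / q) ≤ Q := by
      rw [hQ]
      gcongr
      exact Measure.restrict_le_self
    have a4 : (∫⁻ x in (B i)ᶜ, ‖F x‖ₑ ^ p) ^ (1 / p) ≤ K ^ (1 / p) := by
      gcongr
      exact (setLIntegral_le_lintegral _ _).trans hFK
    have a5 : ∫⁻ x in (B i)ᶜ, ‖F x‖ₑ * ‖h x‖ₑ ≤ c₀ / 2 :=
      (a2.trans (mul_le_mul_left a4 _)).trans hi.le
    have a6 : c₀ / 2 + c₀ / 2 ≤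
        (∫⁻ x in B i, ‖F x‖ₑ ^ p) ^ (1 / p) * Q + c₀ / 2 := by
      rw [ENNReal.add_halves]
      refine hFc.trans (add_le_add (a1.trans ?_) a5)
      gcongr
    exact (ENNReal.add_le_add_iff_right (ENNReal.div_ne_top hc₀' (by simp))).mp a6
  -- delta
  set δ : ℝ≥0∞ := (c₀ / 2 / Q) ^ p with hδ
  have hδ0 : δ ≠ 0 := by
    rw [hδ]
    have : 0 < c₀ / 2 / Q := ENNReal.div_pos hc2.ne' hQt
    exact (ENNReal.rpow_pos_of_nonneg this hp0.le).ne'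
  have low2 : ∀ F : EuclideanSpace ℝ (Fin n) → ℂ, Measurable F → ∫⁻ x, ‖F x‖ₑ ^ p ≤ K →
      c₀ ≤ ∫⁻ x, ‖F x‖ₑ * ‖h x‖ₑ → δ ≤ ∫⁻ x in B i, ‖F x‖ₑ ^ p := by
    intro F hF hFK hFc
    have h1 := ENNReal.div_le_of_le_mul (low F hF hFK hFc)
    calc δ ≤ ((∫⁻ x in B i, ‖F x‖ₑ ^ p) ^ (1 / p)) ^ p := by
          rw [hδ]; gcongr
      _ = _ := by
          rw [← ENNReal.rpow_mul, one_div_mul_cancel hp0.ne', ENNReal.rpow_one]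
  -- number of annuli
  obtain ⟨J, hJ⟩ : ∃ J : ℕ, K < J * δ := by
    obtain ⟨J, hJ⟩ := ENNReal.exists_nat_mul_gt hδ0 hK
    exact ⟨J, hJ⟩
  obtain ⟨G, hGm, hGK, hG⟩ := H ((ρ ^ 2) ^ J) (one_le_pow₀ (one_le_pow₀ hρ1))
  let t : ℕ → ℝ := fun j => (ρ ^ 2) ^ j
  have ht1 : ∀ j, 1 ≤ t j := fun j => one_le_pow₀ (one_le_pow₀ hρ1)
  let Bj : ℕ → Set (EuclideanSpace ℝ (Fin n)) := fun j => (fun x => t j • x) ⁻¹' (B i)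
  have hd : Pairwise (Function.onFun Disjoint Bj) := by
    have key : ∀ a b : ℕ, a < b → Disjoint (Bj a) (Bj b) := by
      intro a b hab
      rw [Set.disjoint_left]
      intro x hxa hxb
      simp only [Bj, B, Set.mem_preimage, Set.mem_ofPred_eq, norm_smul] at hxa hxb
      rw [Real.norm_of_nonneg (by linarith [ht1 a])] at hxa
      rw [Real.norm_of_nonneg (by linarith [ht1 b])] at hxb
      have h1 : ρ ^ 2 * t a ≤ t b := by
        simp only [t]
        rw [mul_comm, ← pow_succ]
        exact pow_le_pow_right₀ (one_le_pow₀ hρ1) hab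
      have h2 : ρ ^ 2 * t a * ‖x‖ ≤ ρ := (mul_le_mul_of_nonneg_right h1 (norm_nonneg _)).trans hxb.2
      have hρ0 : 0 < ρ := by linarith
      have h3 : ρ < ρ ^ 2 * (t a * ‖x‖) := by
        have := mul_lt_mul_of_pos_left hxa.1 (by positivity : 0 < ρ ^ 2)
        have e : ρ ^ 2 * ρ⁻¹ = ρ := by field_simp
        rwa [← hρ, e] at this
      linarith
    intro a b hab
    rcases lt_or_gt_of_ne hab with h' | h'
    · exact key a b h'
    · exact (key b a h').symm
  have each : ∀ j ∈ Finset.range J, δ ≤ ∫⁻ x in Bj j, ‖G x‖ₑ ^ p := by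
    intro j hj
    rw [← scal G hGm (t j) (ht1 j) (B i) (hBm i)]
    apply low2
    · exact (hGm.comp (measurable_const_smul ((t j)⁻¹))).const_smul (t j ^ (s - n) : ℝ)
    · have := scal G hGm (t j) (ht1 j) Set.univ MeasurableSet.univ
      simp only [Measure.restrict_univ, Set.preimage_univ] at this
      rw [this]
      exact hGK
    · exact hG _ (ht1 j) (pow_le_pow_right₀ (one_le_pow₀ hρ1) (Finset.mem_range.mp hj).le)
  have total : (J : ℝ≥0∞) * δ ≤ K := by
    calc (J : ℝ≥0∞) * δ = ∑ j ∈ Finset.range J, δ := by simp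
      _ ≤ ∑ j ∈ Finset.range J, ∫⁻ x in Bj j, ‖G x‖ₑ ^ p := Finset.sum_le_sum each
      _ = ∫⁻ x in ⋃ j ∈ Finset.range J, Bj j, ‖G x‖ₑ ^ p := by
          rw [lintegral_biUnion_finset]
          · exact fun a _ b _ hab => hd hab
          · exact fun j _ => (hBm i).preimage (measurable_const_smul _)
      _ ≤ ∫⁻ x, ‖G x‖ₑ ^ p := setLIntegral_le_lintegral _ _
      _ ≤ K := hGK
  exact absurd total (not_le.mpr hJ)
end L2

section L3
set_option linter.unusedSectionVars false
open scoped FourierTransform LineDeriv SchwartzMap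

variable {n : ℕ} {V E : Type*} [NormedAddCommGroup V] [InnerProductSpace ℝ V]
  [FiniteDimensional ℝ V] [NormedAddCommGroup E] [InnerProductSpace ℝ E] [FiniteDimensional ℝ E]

/-- `z ↦ Re (c z) • b`. -/
def reL (c : ℂ) (b : V) : ℂ →L[ℝ] V :=
  (Complex.reCLM.comp ((ContinuousLinearMap.mul ℝ ℂ) c)).smulRight b

theorem reL_apply (c : ℂ) (b : V) (z : ℂ) : reL c b z = (c * z).re • b := by
  simp [reL]

/-- `i`-th coordinate as a complex number. -/
def coordL (b : V) : V →L[ℝ] ℂ := Complex.ofRealCLM.comp (innerSL ℝ b)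

theorem coordL_apply (b v : V) : coordL b v = ((inner ℝ b v : ℝ) : ℂ) := by
  simp [coordL]

/-- Real part of `c` times the Fourier transform of a vector valued function. -/
def Phi (c : ℂ) (F : 𝓢(EuclideanSpace ℝ (Fin n), V)) : 𝓢(EuclideanSpace ℝ (Fin n), V) :=
  ∑ i, SchwartzMap.postcompCLM (𝕜 := ℝ) (reL c (stdOrthonormalBasis ℝ V i))
    (𝓕 (SchwartzMap.postcompCLM (𝕜 := ℝ) (coordL (stdOrthonormalBasis ℝ V i)) F))

theorem lineDeriv_postcomp {F G : Type*} [NormedAddCommGroup F] [NormedSpace ℝ F]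
    [NormedAddCommGroup G] [NormedSpace ℝ G] (L : F →L[ℝ] G)
    (f : 𝓢(EuclideanSpace ℝ (Fin n), F)) (m : EuclideanSpace ℝ (Fin n)) :
    ∂_{m} (SchwartzMap.postcompCLM (𝕜 := ℝ) L f) = SchwartzMap.postcompCLM (𝕜 := ℝ) L (∂_{m} f) := by
  ext x
  rw [SchwartzMap.lineDerivOp_apply_eq_fderiv]
  change fderiv ℝ (L ∘ f) x m = L (∂_{m} f x)
  rw [fderiv_comp x L.differentiableAt f.differentiableAt, SchwartzMap.lineDerivOp_apply_eq_fderiv]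
  simp

theorem Phi_lineDeriv (c : ℂ) (F : 𝓢(EuclideanSpace ℝ (Fin n), V)) (m : EuclideanSpace ℝ (Fin n)) :
    ∂_{m} (Phi c F) = Phi (-(2 * Real.pi * Complex.I) * c)
      (SchwartzMap.smulLeftCLM V (fun ξ => inner ℝ ξ m) F) := by
  unfold Phi
  have hg : (fun ξ : EuclideanSpace ℝ (Fin n) => inner ℝ ξ m).HasTemperateGrowth := by fun_prop
  rw [LineDeriv.lineDerivOp_sum]
  refine Finset.sum_congr rfl fun i _ => ?_
  rw [lineDeriv_postcomp, SchwartzMap.lineDerivOp_fourier_eq]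
  ext x
  simp only [SchwartzMap.postcompCLM_apply, reL_apply]
  congr 2
  rw [FourierTransform.fourier_smul, smul_apply, smul_eq_mul]
  have : SchwartzMap.smulLeftCLM ℂ (fun ξ => inner ℝ ξ m)
      (SchwartzMap.postcompCLM (𝕜 := ℝ) (coordL (stdOrthonormalBasis ℝ V i)) F) =
      SchwartzMap.postcompCLM (𝕜 := ℝ) (coordL (stdOrthonormalBasis ℝ V i))
      (SchwartzMap.smulLeftCLM V (fun ξ => inner ℝ ξ m) F) := by
    ext y
    simp [SchwartzMap.smulLeftCLM_apply_apply hg, SchwartzMap.postcompCLM_apply]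
  rw [this]
  ring

theorem integrable_kernel {G : Type*} [NormedAddCommGroup G] [NormedSpace ℝ G] (c : ℂ)
    (f : EuclideanSpace ℝ (Fin n) → G) (hf : Integrable f) (x : EuclideanSpace ℝ (Fin n)) :
    Integrable (fun ξ => (c * (Real.fourierChar (-inner ℝ ξ x) : ℂ)).re • f ξ) := by
  refine Integrable.bdd_smul hf ‖c‖ ?_ (ae_of_all _ fun ξ => ?_)
  · apply Continuous.aestronglyMeasurable
    fun_prop
  · refine (Complex.abs_re_le_norm _).trans ?_
    rw [norm_mul, Circle.norm_coe, mul_one]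

theorem fourier_re (c : ℂ) (f : EuclideanSpace ℝ (Fin n) → ℝ) (hf : Integrable f)
    (x : EuclideanSpace ℝ (Fin n)) :
    (c * 𝓕 (fun ξ => (f ξ : ℂ)) x).re =
      ∫ ξ, (c * (Real.fourierChar (-inner ℝ ξ x) : ℂ)).re * f ξ := by
  rw [Real.fourier_eq, ← integral_const_mul]
  have h1 : Integrable (fun ξ => c * (Real.fourierChar (-inner ℝ ξ x) • (f ξ : ℂ))) := by
    refine Integrable.const_mul ?_ _
    exact (Real.fourierIntegral_convergent_iff x).2 hf.ofReal
  have := (Complex.reCLM.integral_comp_comm h1)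
  simp only [Complex.reCLM_apply] at this
  rw [← this]
  congr 1
  ext ξ
  rw [Circle.smul_def, smul_eq_mul, ← mul_assoc, Complex.re_mul_ofReal]

theorem Phi_apply (c : ℂ) (F : 𝓢(EuclideanSpace ℝ (Fin n), V)) (x : EuclideanSpace ℝ (Fin n)) :
    Phi c F x = ∫ ξ, (c * (Real.fourierChar (-inner ℝ ξ x) : ℂ)).re • F ξ := by
  unfold Phi
  rw [sum_apply]
  have h1 : ∀ ξ, (c * (Real.fourierChar (-inner ℝ ξ x) : ℂ)).re • F ξ =
      ∑ i, ((c * (Real.fourierChar (-inner ℝ ξ x) : ℂ)).re *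
        inner ℝ (stdOrthonormalBasis ℝ V i) (F ξ)) • stdOrthonormalBasis ℝ V i := by
    intro ξ
    conv_lhs => rw [← (stdOrthonormalBasis ℝ V).sum_repr' (F ξ), Finset.smul_sum]
    simp_rw [smul_smul]
  simp_rw [h1]
  have hi : ∀ i, Integrable (fun ξ => inner ℝ (stdOrthonormalBasis ℝ V i) (F ξ)) := fun i =>
    F.integrable.const_inner _
  rw [integral_finsetSum]
  · refine Finset.sum_congr rfl fun i _ => ?_
    rw [integral_smul_const, ← fourier_re c _ (hi i)]
    rw [SchwartzMap.postcompCLM_apply, reL_apply, SchwartzMap.fourier_coe]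
    congr 5
  · intro i _
    exact (integrable_kernel c _ (hi i) x).smul_const _

theorem pd_Phi_iter (c : ℂ) (F : 𝓢(EuclideanSpace ℝ (Fin n), V)) (i : Fin n) (m : ℕ) :
    ∃ G : 𝓢(EuclideanSpace ℝ (Fin n), V), (∀ ξ, G ξ = (ξ i ^ m) • F ξ) ∧
      (pd i)^[m] (Phi c F) = Phi ((-(2 * Real.pi * Complex.I)) ^ m * c) G := by
  induction m with
  | zero => exact ⟨F, by simp, by simp⟩
  | succ m ih =>
    obtain ⟨G, hG, hG2⟩ := ih
    have hg : (fun ξ : EuclideanSpace ℝ (Fin n) =>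
        inner ℝ ξ (EuclideanSpace.single i (1 : ℝ))).HasTemperateGrowth := by fun_prop
    refine ⟨SchwartzMap.smulLeftCLM V
      (fun ξ => inner ℝ ξ (EuclideanSpace.single i (1 : ℝ))) G, fun ξ => ?_, ?_⟩
    · rw [SchwartzMap.smulLeftCLM_apply_apply hg, hG, smul_smul]
      simp [EuclideanSpace.inner_single_right, pow_succ']
    · rw [Function.iterate_succ_apply', hG2]
      have := Phi_lineDeriv ((-(2 * Real.pi * Complex.I)) ^ m * c) G (EuclideanSpace.single i (1 : ℝ))
      rw [← mul_assoc, ← pow_succ'] at this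
      rw [← this]
      rfl

theorem pdMulti_Phi (c : ℂ) (F : 𝓢(EuclideanSpace ℝ (Fin n), V)) (α : Fin n → ℕ) :
    ∃ G : 𝓢(EuclideanSpace ℝ (Fin n), V), (∀ ξ, G ξ = (∏ i, ξ i ^ α i) • F ξ) ∧
      pdMulti α (Phi c F) = Phi ((-(2 * Real.pi * Complex.I)) ^ (∑ i, α i) * c) G := by
  have key : ∀ l : List (Fin n), ∃ G : 𝓢(EuclideanSpace ℝ (Fin n), V),
      (∀ ξ, G ξ = (l.map (fun i => ξ i ^ α i)).prod • F ξ) ∧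
      l.foldr (fun i v => (pd i)^[α i] v) (Phi c F) =
        Phi ((-(2 * Real.pi * Complex.I)) ^ ((l.map α).sum) * c) G := by
    intro l
    induction l with
    | nil => exact ⟨F, by simp, by simp⟩
    | cons i l ih =>
      obtain ⟨G, hG, hG2⟩ := ih
      obtain ⟨G', hG', hG2'⟩ := pd_Phi_iter ((-(2 * Real.pi * Complex.I)) ^ ((l.map α).sum) * c) G
        i (α i)
      refine ⟨G', fun ξ => ?_, ?_⟩
      · rw [hG', hG, smul_smul, List.map_cons, List.prod_cons]
      · rw [List.foldr_cons, hG2, hG2', List.map_cons, List.sum_cons, pow_add, mul_assoc (_ ^ α i)]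
  obtain ⟨G, hG, hG2⟩ := key (List.finRange n)
  refine ⟨G, fun ξ => ?_, ?_⟩
  · rw [hG, Fin.prod_univ_def]
  · rw [← sum_finRange]
    exact hG2

theorem opApply_Phi (k : ℕ) (A : (Fin n → ℕ) → (V →ₗ[ℝ] E)) (c : ℂ)
    (F : 𝓢(EuclideanSpace ℝ (Fin n), V)) (x : EuclideanSpace ℝ (Fin n)) :
    opApply k A (Phi c F) x = ∫ ξ, (((-(2 * Real.pi * Complex.I)) ^ k * c) *
      (Real.fourierChar (-inner ℝ ξ x) : ℂ)).re • symb k A ξ (F ξ) := by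
  unfold opApply symb
  choose G hG hG2 using fun α => pdMulti_Phi c F α
  set c' := (-(2 * Real.pi * Complex.I)) ^ k * c with hc'
  have h1 : ∀ α ∈ Finset.Nat.antidiagonalTuple n k, A α (pdMulti α (Phi c F) x) =
      ∫ ξ, (c' * (Real.fourierChar (-inner ℝ ξ x) : ℂ)).re • A α (G α ξ) := by
    intro α hα
    rw [hG2, Finset.Nat.mem_antidiagonalTuple.mp hα, ← hc', Phi_apply]
    have := ((A α).toContinuousLinearMap).integral_comp_comm
      (integrable_kernel c' (G α) (G α).integrable x)
    simp only [LinearMap.coe_toContinuousLinearMap', map_smul] at this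
    exact this.symm
  rw [Finset.sum_congr rfl h1, ← integral_finsetSum]
  · congr 1
    ext ξ
    rw [← Finset.smul_sum]
    congr 1
    simp [hG]
  · intro α _
    exact integrable_kernel c' _
      (((A α).toContinuousLinearMap).integrable_comp (G α).integrable) x

theorem iter_Phi (ℓ : ℕ) (c : ℂ) (F : 𝓢(EuclideanSpace ℝ (Fin n), V)) (m : EuclideanSpace ℝ (Fin n)) :
    ∃ G : 𝓢(EuclideanSpace ℝ (Fin n), V), (∀ ξ, G ξ = (inner ℝ ξ m ^ ℓ) • F ξ) ∧
      ∀ x, iteratedFDeriv ℝ ℓ (Phi c F) x (fun _ => m) =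
        Phi ((-(2 * Real.pi * Complex.I)) ^ ℓ * c) G x := by
  have key : ∃ G : 𝓢(EuclideanSpace ℝ (Fin n), V), (∀ ξ, G ξ = (inner ℝ ξ m ^ ℓ) • F ξ) ∧
      ∂^{fun _ : Fin ℓ => m} (Phi c F) = Phi ((-(2 * Real.pi * Complex.I)) ^ ℓ * c) G := by
    induction ℓ with
    | zero => exact ⟨F, by simp, by simp⟩
    | succ ℓ ih =>
      obtain ⟨G, hG, hG2⟩ := ih
      have hg : (fun ξ : EuclideanSpace ℝ (Fin n) => inner ℝ ξ m).HasTemperateGrowth := by fun_prop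
      refine ⟨SchwartzMap.smulLeftCLM V (fun ξ => inner ℝ ξ m) G, fun ξ => ?_, ?_⟩
      · rw [SchwartzMap.smulLeftCLM_apply_apply hg, hG, smul_smul, pow_succ']
      · rw [LineDeriv.iteratedLineDerivOp_succ_left]
        have e : Fin.tail (fun _ : Fin (ℓ + 1) => m) = fun _ => m := rfl
        rw [e, hG2, Phi_lineDeriv, ← mul_assoc, ← pow_succ']
  obtain ⟨G, hG, hG2⟩ := key
  refine ⟨G, hG, fun x => ?_⟩
  rw [← hG2, SchwartzMap.iteratedLineDerivOp_eq_iteratedFDeriv]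

theorem inner_Phi (c : ℂ) (F : 𝓢(EuclideanSpace ℝ (Fin n), V)) (b : V)
    (x : EuclideanSpace ℝ (Fin n)) :
    inner ℝ b (Phi c F x) = (c * 𝓕 (fun ξ => ((inner ℝ b (F ξ) : ℝ) : ℂ)) x).re := by
  rw [fourier_re c _ (F.integrable.const_inner _), Phi_apply, ← integral_inner]
  · simp_rw [inner_smul_right]
  · exact integrable_kernel c F F.integrable x
end L3

section L4
set_option linter.unusedSectionVars false
open scoped FourierTransform LineDeriv SchwartzMap ENNReal

variable {n : ℕ} {V E : Type*} [NormedAddCommGroup V] [InnerProductSpace ℝ V]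
  [FiniteDimensional ℝ V] [NormedAddCommGroup E] [InnerProductSpace ℝ E] [FiniteDimensional ℝ E]

theorem symb_smul (k : ℕ) (A : (Fin n → ℕ) → (V →ₗ[ℝ] E)) (t : ℝ)
    (ξ : EuclideanSpace ℝ (Fin n)) : symb k A (t • ξ) = t ^ k • symb k A ξ := by
  unfold symb
  rw [Finset.smul_sum]
  refine Finset.sum_congr rfl fun α hα => ?_
  rw [smul_smul]
  congr 1
  simp only [PiLp.smul_apply, smul_eq_mul, mul_pow, Finset.prod_mul_distrib]
  rw [Finset.prod_pow_eq_pow_sum, Finset.Nat.mem_antidiagonalTuple.mp hα]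

theorem exists_a (k : ℕ) (A : (Fin n → ℕ) → (V →ₗ[ℝ] E))
    (hell : ∀ ξ : EuclideanSpace ℝ (Fin n), ξ ≠ 0 → Function.Injective (symb k A ξ))
    (e : E) (he : ∀ ξ : EuclideanSpace ℝ (Fin n), ξ ≠ 0 → e ∈ LinearMap.range (symb k A ξ)) :
    ∃ a : EuclideanSpace ℝ (Fin n) → V, (∀ ξ, ξ ≠ 0 → ContDiffAt ℝ (⊤ : ℕ∞) a ξ) ∧
      (∀ ξ, ξ ≠ 0 → symb k A ξ (a ξ) = e) ∧
      (∀ (t : ℝ) ξ, 0 < t → ξ ≠ 0 → a (t • ξ) = (t ^ k)⁻¹ • a ξ) := by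
  have : CompleteSpace V := FiniteDimensional.complete ℝ V
  have : CompleteSpace E := FiniteDimensional.complete ℝ E
  let P : (Fin n → ℕ) → EuclideanSpace ℝ (Fin n) → ℝ := fun α ξ => ∏ i, ξ i ^ α i
  have hP : ∀ α, ContDiff ℝ (⊤ : ℕ∞) (P α) := fun α =>
    contDiff_prod fun i _ => ContDiff.pow (by fun_prop) _
  let S : EuclideanSpace ℝ (Fin n) → (V →L[ℝ] E) := fun ξ =>
    ∑ α ∈ Finset.Nat.antidiagonalTuple n k, P α ξ • (A α).toContinuousLinearMap
  let S' : EuclideanSpace ℝ (Fin n) → (E →L[ℝ] V) := fun ξ =>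
    ∑ α ∈ Finset.Nat.antidiagonalTuple n k,
      P α ξ • ContinuousLinearMap.adjoint (A α).toContinuousLinearMap
  have hSs : ∀ ξ v, S ξ v = symb k A ξ v := by
    intro ξ v
    simp [S, symb, P]
  have hadj : ∀ ξ v w, inner ℝ (S' ξ w) v = inner ℝ w (S ξ v) := by
    intro ξ v w
    simp only [S, S', sum_apply, smul_apply, sum_inner, inner_sum,
      inner_smul_left, inner_smul_right, ContinuousLinearMap.adjoint_inner_left]
    simp
  have hS : ContDiff ℝ (⊤ : ℕ∞) S := ContDiff.sum fun α _ => (hP α).smul contDiff_const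
  have hS' : ContDiff ℝ (⊤ : ℕ∞) S' := ContDiff.sum fun α _ => (hP α).smul contDiff_const
  let T : EuclideanSpace ℝ (Fin n) → (V →L[ℝ] V) := fun ξ => (S' ξ).comp (S ξ)
  have hT : ContDiff ℝ (⊤ : ℕ∞) T := hS'.clm_comp hS
  have hTinj : ∀ ξ, ξ ≠ 0 → Function.Injective (T ξ) := by
    intro ξ hξ
    rw [injective_iff_map_eq_zero]
    intro v hv
    have h1 : inner ℝ (T ξ v) v = inner ℝ (S ξ v) (S ξ v) := hadj ξ v (S ξ v)
    rw [hv, inner_zero_left] at h1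
    have h2 := inner_self_eq_zero.mp h1.symm
    rw [hSs] at h2
    exact (injective_iff_map_eq_zero _).mp (hell ξ hξ) v h2
  have hTu : ∀ ξ, ξ ≠ 0 → IsUnit (T ξ) := by
    intro ξ hξ
    let L := (LinearEquiv.ofInjectiveEndo (T ξ : V →ₗ[ℝ] V) (hTinj ξ hξ)).toContinuousLinearEquiv
    refine ⟨ContinuousLinearEquiv.toUnit L, ?_⟩
    ext v
    rfl
  let a : EuclideanSpace ℝ (Fin n) → V := fun ξ => Ring.inverse (T ξ) (S' ξ e)
  have ha1 : ∀ ξ, ξ ≠ 0 → symb k A ξ (a ξ) = e := by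
    intro ξ hξ
    obtain ⟨v, hv⟩ := he ξ hξ
    have h1 : S' ξ e = T ξ v := by
      rw [← hv, ← hSs]; rfl
    have h2 : a ξ = v := by
      change Ring.inverse (T ξ) (S' ξ e) = v
      rw [h1, ← ContinuousLinearMap.mul_apply, Ring.inverse_mul_cancel _ (hTu ξ hξ)]
      rfl
    rw [h2, hv]
  refine ⟨a, ?_, ha1, ?_⟩
  · intro ξ hξ
    have h1 : ContDiffAt ℝ (⊤ : ℕ∞) (fun ξ => Ring.inverse (T ξ)) ξ := by
      obtain ⟨u, hu⟩ := hTu ξ hξ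
      have h3 := contDiffAt_ringInverse ℝ u (n := (⊤ : ℕ∞))
      rw [hu] at h3
      exact h3.comp ξ hT.contDiffAt
    exact h1.clm_apply (hS'.contDiffAt.clm_apply contDiffAt_const)
  · intro t ξ ht hξ
    apply hell ξ hξ
    have h1 := ha1 (t • ξ) (smul_ne_zero ht.ne' hξ)
    rw [symb_smul, LinearMap.smul_apply] at h1
    rw [map_smul, ha1 ξ hξ, ← h1, smul_smul, inv_mul_cancel₀ (by positivity), one_smul]

theorem fourier_scale (f : EuclideanSpace ℝ (Fin n) → ℂ) (t : ℝ) (ht : 0 < t)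
    (x : EuclideanSpace ℝ (Fin n)) :
    𝓕 (fun ξ => f (t • ξ)) x = ((t ^ n)⁻¹ : ℝ) • 𝓕 f (t⁻¹ • x) := by
  rw [Real.fourier_eq, Real.fourier_eq]
  have h := Measure.integral_comp_smul (volume : Measure (EuclideanSpace ℝ (Fin n)))
    (fun ξ => Real.fourierChar (-inner ℝ ξ (t⁻¹ • x)) • f ξ) t
  rw [finrank_euclideanSpace, Fintype.card_fin, abs_of_nonneg (by positivity)] at h
  rw [← h]
  congr 1
  ext ξ
  rw [inner_smul_left, inner_smul_right]
  congr 3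
  simp [ht.ne']

theorem fourier_scale_L1 (f : EuclideanSpace ℝ (Fin n) → ℂ) (t : ℝ) (ht : 0 < t) :
    ∫ x, ‖𝓕 (fun ξ => f (t • ξ)) x‖ = ∫ x, ‖𝓕 f x‖ := by
  simp_rw [fourier_scale f t ht, norm_smul]
  rw [integral_const_mul]
  have h := Measure.integral_comp_smul (volume : Measure (EuclideanSpace ℝ (Fin n)))
    (fun ξ => ‖𝓕 f ξ‖) t⁻¹
  rw [h, finrank_euclideanSpace, Fintype.card_fin, abs_of_nonneg (by positivity),
    Real.norm_of_nonneg (by positivity), smul_eq_mul, ← mul_assoc]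
  rw [inv_pow, inv_inv, inv_mul_cancel₀ (by positivity), one_mul]

/-- Cutoff to a frequency annulus. -/
theorem exists_cutoff (n : ℕ) : ∃ M : ℝ, ∀ R : ℝ, 1 ≤ R →
    ∃ φ : EuclideanSpace ℝ (Fin n) → ℝ, ContDiff ℝ (⊤ : ℕ∞) φ ∧ HasCompactSupport φ ∧
      φ =ᶠ[𝓝 0] 0 ∧ (∀ ξ, 2 / R ≤ ‖ξ‖ → ‖ξ‖ ≤ R → φ ξ = 1) ∧
      ∫ x, ‖𝓕 (fun ξ => (φ ξ : ℂ)) x‖ ≤ M := by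
  let η : ContDiffBump (0 : EuclideanSpace ℝ (Fin n)) := ⟨1, 2, one_pos, one_lt_two⟩
  have hη : ContDiff ℝ (⊤ : ℕ∞) η := η.contDiff
  have key : ∀ t : ℝ, 0 < t → ContDiff ℝ (⊤ : ℕ∞) (fun ξ => η (t • ξ)) ∧
      HasCompactSupport (fun ξ => η (t • ξ)) := fun t ht =>
    ⟨hη.comp (contDiff_const_smul _), η.hasCompactSupport.comp_smul ht.ne'⟩
  have key2 : ∀ t : ℝ, 0 < t → Integrable (fun x => 𝓕 (fun ξ => ((η (t • ξ) : ℝ) : ℂ)) x) := by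
    intro t ht
    have h1 : ContDiff ℝ (⊤ : ℕ∞) (fun ξ => ((η (t • ξ) : ℝ) : ℂ)) :=
      Complex.ofRealCLM.contDiff.comp (key t ht).1
    have h2 : HasCompactSupport (fun ξ => ((η (t • ξ) : ℝ) : ℂ)) :=
      (key t ht).2.comp_left (g := fun x : ℝ => (x : ℂ)) (by simp)
    exact (𝓕 (h2.toSchwartzMap h1)).integrable
  have key3 : ∀ t : ℝ, 0 < t → Integrable (fun ξ => ((η (t • ξ) : ℝ) : ℂ)) := fun t ht =>
    ((key t ht).1.continuous.integrable_of_hasCompactSupport (key t ht).2).ofReal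
  refine ⟨2 * ∫ x, ‖𝓕 (fun ξ => ((η ξ : ℝ) : ℂ)) x‖, fun R hR => ?_⟩
  have hR0 : 0 < R := by linarith
  have hRi : 0 < R⁻¹ := by positivity
  refine ⟨fun ξ => η (R⁻¹ • ξ) - η (R • ξ), (key _ hRi).1.sub (key _ hR0).1, ?_, ?_, ?_, ?_⟩
  · exact (key _ hRi).2.sub (key _ hR0).2
  · filter_upwards [Metric.ball_mem_nhds (0 : EuclideanSpace ℝ (Fin n)) hRi] with ξ hξ
    rw [mem_ball_zero_iff] at hξ
    have h1 : η (R • ξ) = 1 := by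
      apply η.one_of_mem_closedBall
      rw [mem_closedBall_zero_iff, norm_smul, Real.norm_of_nonneg hR0.le]
      have := mul_le_mul_of_nonneg_left hξ.le hR0.le
      rwa [mul_inv_cancel₀ hR0.ne'] at this
    have h2 : η (R⁻¹ • ξ) = 1 := by
      apply η.one_of_mem_closedBall
      rw [mem_closedBall_zero_iff, norm_smul, Real.norm_of_nonneg hRi.le]
      have h3 : R⁻¹ ≤ 1 := inv_le_one_of_one_le₀ hR
      change R⁻¹ * ‖ξ‖ ≤ 1
      nlinarith [norm_nonneg ξ]
    simp [h1, h2]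
  · intro ξ h1 h2
    have h3 : η (R⁻¹ • ξ) = 1 := by
      apply η.one_of_mem_closedBall
      rw [mem_closedBall_zero_iff, norm_smul, Real.norm_of_nonneg hRi.le]
      have := mul_le_mul_of_nonneg_left h2 hRi.le
      rwa [inv_mul_cancel₀ hR0.ne'] at this
    have h4 : η (R • ξ) = 0 := by
      apply η.zero_of_le_dist
      rw [dist_zero_right, norm_smul, Real.norm_of_nonneg hR0.le]
      rw [div_le_iff₀ hR0] at h1
      change 2 ≤ R * ‖ξ‖
      linarith
    simp only [h3, h4, sub_zero]
  · have e : ∀ x, 𝓕 (fun ξ => ((η (R⁻¹ • ξ) - η (R • ξ) : ℝ) : ℂ)) x =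
        𝓕 (fun ξ => ((η (R⁻¹ • ξ) : ℝ) : ℂ)) x - 𝓕 (fun ξ => ((η (R • ξ) : ℝ) : ℂ)) x := by
      intro x
      rw [Real.fourier_eq, Real.fourier_eq, Real.fourier_eq, ← integral_sub]
      · simp [smul_sub]
      · exact (Real.fourierIntegral_convergent_iff x).2 (key3 _ hRi)
      · exact (Real.fourierIntegral_convergent_iff x).2 (key3 _ hR0)
    simp_rw [e]
    calc _ ≤ ∫ x, (‖𝓕 (fun ξ => ((η (R⁻¹ • ξ) : ℝ) : ℂ)) x‖ +
          ‖𝓕 (fun ξ => ((η (R • ξ) : ℝ) : ℂ)) x‖) :=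
          integral_mono ((key2 _ hRi).sub (key2 _ hR0)).norm
            ((key2 _ hRi).norm.add (key2 _ hR0).norm) fun x => norm_sub_le _ _
      _ = _ := by
          rw [integral_add (key2 _ hRi).norm (key2 _ hR0).norm,
            fourier_scale_L1 (fun ξ => ((η ξ : ℝ) : ℂ)) _ hRi,
            fourier_scale_L1 (fun ξ => ((η ξ : ℝ) : ℂ)) _ hR0, two_mul]
end L4

section L5
set_option linter.unusedSectionVars false
open scoped FourierTransform LineDeriv SchwartzMap ENNReal

variable {n : ℕ} {V E : Type*} [NormedAddCommGroup V] [InnerProductSpace ℝ V]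
  [FiniteDimensional ℝ V] [NormedAddCommGroup E] [InnerProductSpace ℝ E] [FiniteDimensional ℝ E]

theorem upper_re (k ℓ : ℕ) (A : (Fin n → ℕ) → (V →ₗ[ℝ] E)) (p C M : ℝ) (hp : 0 < p) (hC : 0 < C)
    (hE : ∀ u : 𝓢(EuclideanSpace ℝ (Fin n), V),
      ∫⁻ x, ENNReal.ofReal (‖iteratedFDeriv ℝ ℓ u x‖ ^ p) ≤
        ENNReal.ofReal ((C * ∫ x, ‖opApply k A u x‖) ^ p))
    (e : E) (φ : EuclideanSpace ℝ (Fin n) → ℝ) (hφ : Integrable φ)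
    (hφ' : Integrable (𝓕 (fun ξ => (φ ξ : ℂ))))
    (hM : ∫ x, ‖𝓕 (fun ξ => (φ ξ : ℂ)) x‖ ≤ M)
    (F : 𝓢(EuclideanSpace ℝ (Fin n), V)) (hF : ∀ ξ, symb k A ξ (F ξ) = φ ξ • e)
    (ξ0 : EuclideanSpace ℝ (Fin n)) (b : V) (c : ℂ) (hc : ‖c‖ = 1) :
    ∫⁻ x, ‖(c * 𝓕 (fun ξ => ((inner ℝ ξ ξ0 ^ ℓ * inner ℝ b (F ξ) : ℝ) : ℂ)) x).re‖ₑ ^ p ≤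
      ENNReal.ofReal ((‖b‖ * ‖ξ0‖ ^ ℓ) ^ p) * ENNReal.ofReal
        ((C * (‖(-(2 * Real.pi * Complex.I)) ^ k * ((-(2 * Real.pi * Complex.I)) ^ ℓ)⁻¹‖ * M * ‖e‖)) ^ p) := by
  set w : ℂ := -(2 * Real.pi * Complex.I) with hw
  have hw0 : w ≠ 0 := by
    simp [hw, Complex.I_ne_zero, Real.pi_ne_zero]
  obtain ⟨G, hG, hG2⟩ := iter_Phi ℓ ((w ^ ℓ)⁻¹ * c) F ξ0
  have hcc : w ^ ℓ * ((w ^ ℓ)⁻¹ * c) = c := by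
    rw [← mul_assoc, mul_inv_cancel₀ (pow_ne_zero _ hw0), one_mul]
  rw [← hw, hcc] at hG2
  set u := Phi ((w ^ ℓ)⁻¹ * c) F with hu
  have h1 : ∀ x, (c * 𝓕 (fun ξ => ((inner ℝ ξ ξ0 ^ ℓ * inner ℝ b (F ξ) : ℝ) : ℂ)) x).re =
      inner ℝ b (iteratedFDeriv ℝ ℓ u x (fun _ => ξ0)) := by
    intro x
    rw [hG2, inner_Phi]
    simp only [hG, inner_smul_right]
  have h2 : ∀ x, ‖(c * 𝓕 (fun ξ => ((inner ℝ ξ ξ0 ^ ℓ * inner ℝ b (F ξ) : ℝ) : ℂ)) x).re‖ ≤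
      (‖b‖ * ‖ξ0‖ ^ ℓ) * ‖iteratedFDeriv ℝ ℓ u x‖ := by
    intro x
    rw [h1]
    refine (norm_inner_le_norm _ _).trans ?_
    have := (iteratedFDeriv ℝ ℓ u x).le_opNorm (fun _ => ξ0)
    simp only [Finset.prod_const, Finset.card_univ, Fintype.card_fin] at this
    calc _ ≤ ‖b‖ * (‖iteratedFDeriv ℝ ℓ u x‖ * ‖ξ0‖ ^ ℓ) := by gcongr
      _ = _ := by ring
  have h3 : ∀ x, opApply k A u x = ((w ^ k * ((w ^ ℓ)⁻¹ * c)) * 𝓕 (fun ξ => (φ ξ : ℂ)) x).re • e := by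
    intro x
    rw [hu, opApply_Phi, fourier_re _ _ hφ, ← integral_smul_const]
    simp only [hF, smul_smul, ← hw]
  have h4 : ∫ x, ‖opApply k A u x‖ ≤ ‖w ^ k * (w ^ ℓ)⁻¹‖ * M * ‖e‖ := by
    calc ∫ x, ‖opApply k A u x‖ ≤ ∫ x, (‖w ^ k * (w ^ ℓ)⁻¹‖ * ‖e‖) * ‖𝓕 (fun ξ => (φ ξ : ℂ)) x‖ := by
          refine integral_mono_of_nonneg (ae_of_all _ fun x => norm_nonneg _)
            (hφ'.norm.const_mul _) (ae_of_all _ fun x => ?_)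
          simp only
          rw [h3, norm_smul]
          have : ‖((w ^ k * ((w ^ ℓ)⁻¹ * c)) * 𝓕 (fun ξ => (φ ξ : ℂ)) x).re‖ ≤
              ‖w ^ k * (w ^ ℓ)⁻¹‖ * ‖𝓕 (fun ξ => (φ ξ : ℂ)) x‖ := by
            refine (Complex.abs_re_le_norm _).trans ?_
            rw [← mul_assoc, norm_mul, norm_mul _ c, hc, mul_one]
          calc _ ≤ (‖w ^ k * (w ^ ℓ)⁻¹‖ * ‖𝓕 (fun ξ => (φ ξ : ℂ)) x‖) * ‖e‖ := by gcongr
            _ = _ := by ring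
      _ = (‖w ^ k * (w ^ ℓ)⁻¹‖ * ‖e‖) * ∫ x, ‖𝓕 (fun ξ => (φ ξ : ℂ)) x‖ := integral_const_mul _ _
      _ ≤ (‖w ^ k * (w ^ ℓ)⁻¹‖ * ‖e‖) * M := by gcongr
      _ = _ := by ring
  calc _ ≤ ∫⁻ x, ENNReal.ofReal ((‖b‖ * ‖ξ0‖ ^ ℓ) ^ p) *
        ENNReal.ofReal (‖iteratedFDeriv ℝ ℓ u x‖ ^ p) := by
        refine lintegral_mono fun x => ?_
        rw [← ENNReal.ofReal_mul (by positivity), ← Real.mul_rpow (by positivity) (by positivity),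
          ← ofReal_norm, ENNReal.ofReal_rpow_of_nonneg (norm_nonneg _) hp.le]
        exact ENNReal.ofReal_le_ofReal (Real.rpow_le_rpow (norm_nonneg _) (h2 x) hp.le)
    _ = ENNReal.ofReal ((‖b‖ * ‖ξ0‖ ^ ℓ) ^ p) *
        ∫⁻ x, ENNReal.ofReal (‖iteratedFDeriv ℝ ℓ u x‖ ^ p) :=
        lintegral_const_mul' _ _ ENNReal.ofReal_ne_top
    _ ≤ _ := by
        gcongr
        refine (hE u).trans (ENNReal.ofReal_le_ofReal ?_)
        have : 0 ≤ ∫ x, ‖opApply k A u x‖ := integral_nonneg fun x => norm_nonneg _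
        exact Real.rpow_le_rpow (by positivity) (by gcongr) hp.le

theorem enorm_le_re_im (z : ℂ) : ‖z‖ₑ ≤ ‖(1 * z).re‖ₑ + ‖(-Complex.I * z).re‖ₑ := by
  rw [← ofReal_norm, ← ofReal_norm, ← ofReal_norm, ← ENNReal.ofReal_add (norm_nonneg _) (norm_nonneg _)]
  apply ENNReal.ofReal_le_ofReal
  simpa using Complex.norm_le_abs_re_add_abs_im z

theorem upper_full (g : EuclideanSpace ℝ (Fin n) → ℂ) (hg : Measurable g) (p : ℝ) (hp : 1 ≤ p)
    (K : ℝ≥0∞) (h : ∀ c : ℂ, ‖c‖ = 1 → ∫⁻ x, ‖(c * g x).re‖ₑ ^ p ≤ K) :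
    ∫⁻ x, ‖g x‖ₑ ^ p ≤ 2 ^ (p - 1) * (K + K) := by
  have hm : Measurable fun x => ‖(1 * g x).re‖ₑ ^ p := by fun_prop
  calc _ ≤ ∫⁻ x, 2 ^ (p - 1) * (‖(1 * g x).re‖ₑ ^ p + ‖(-Complex.I * g x).re‖ₑ ^ p) := by
        refine lintegral_mono fun x => ?_
        refine le_trans ?_ (ENNReal.rpow_add_le_mul_rpow_add_rpow _ _ hp)
        exact ENNReal.rpow_le_rpow (enorm_le_re_im _) (by linarith)
    _ = 2 ^ (p - 1) * ∫⁻ x, (‖(1 * g x).re‖ₑ ^ p + ‖(-Complex.I * g x).re‖ₑ ^ p) :=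
        lintegral_const_mul' _ _ (ENNReal.rpow_ne_top_of_nonneg (by linarith) (by simp))
    _ = 2 ^ (p - 1) * ((∫⁻ x, ‖(1 * g x).re‖ₑ ^ p) + ∫⁻ x, ‖(-Complex.I * g x).re‖ₑ ^ p) := by
        rw [lintegral_add_left hm]
    _ ≤ _ := by
        gcongr
        · exact h 1 (by simp)
        · exact h (-Complex.I) (by simp)

/-- A real smooth function on the complement of the origin times a cutoff is smooth. -/
theorem contDiff_cut (φ : EuclideanSpace ℝ (Fin n) → ℝ) (hφ : ContDiff ℝ (⊤ : ℕ∞) φ)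
    (h0 : φ =ᶠ[𝓝 0] 0) (a : EuclideanSpace ℝ (Fin n) → V)
    (ha : ∀ ξ, ξ ≠ 0 → ContDiffAt ℝ (⊤ : ℕ∞) a ξ) : ContDiff ℝ (⊤ : ℕ∞) (fun ξ => φ ξ • a ξ) := by
  rw [contDiff_iff_contDiffAt]
  intro ξ
  by_cases h : ξ = 0
  · subst h
    refine (contDiffAt_const (c := (0 : V))).congr_of_eventuallyEq ?_
    filter_upwards [h0] with y hy
    simp [hy]
  · exact hφ.contDiffAt.smul (ha ξ h)

theorem pairing (f ψ : 𝓢(EuclideanSpace ℝ (Fin n), ℂ)) (s t : ℝ) (ht : 0 < t)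
    (g : EuclideanSpace ℝ (Fin n) → ℂ)
    (hg : ∀ ξ, ((t ^ s : ℝ) : ℂ) * f (t • ξ) * ψ ξ = g ξ) :
    ‖∫ ξ, g ξ‖ₑ ≤ ∫⁻ x, ‖(t ^ (s - n) : ℝ) • (𝓕 f) (t⁻¹ • x)‖ₑ * ‖(𝓕⁻ ψ) x‖ₑ := by
  let L : EuclideanSpace ℝ (Fin n) ≃L[ℝ] EuclideanSpace ℝ (Fin n) :=
    ContinuousLinearEquiv.smulLeft (Units.mk0 t ht.ne')
  let ft : 𝓢(EuclideanSpace ℝ (Fin n), ℂ) := SchwartzMap.compCLMOfContinuousLinearEquiv ℝ L f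
  have hft : ∀ ξ, ft ξ = f (t • ξ) := fun ξ => rfl
  have h1 : ∀ x, (𝓕 ft) x = ((t ^ n)⁻¹ : ℝ) • (𝓕 f) (t⁻¹ • x) := by
    intro x
    rw [SchwartzMap.fourier_coe, SchwartzMap.fourier_coe, ← fourier_scale f t ht x]
    rfl
  have h2 := SchwartzMap.integral_fourier_mul_eq ft (𝓕⁻ ψ)
  rw [FourierTransform.fourier_fourierInv_eq] at h2
  have h3 : ∫ ξ, g ξ = ∫ x, ((t ^ (s - n) : ℝ) • (𝓕 f) (t⁻¹ • x)) * (𝓕⁻ ψ) x := by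
    have e1 : ∫ ξ, g ξ = ((t ^ s : ℝ) : ℂ) * ∫ ξ, ft ξ * ψ ξ := by
      rw [← integral_const_mul]
      refine integral_congr_ae (ae_of_all _ fun ξ => ?_)
      simp only [hft, ← hg, mul_assoc]
    rw [e1, ← h2, ← integral_const_mul]
    refine integral_congr_ae (ae_of_all _ fun x => ?_)
    simp only [h1]
    rw [Real.rpow_sub ht, Real.rpow_natCast, Complex.real_smul, Complex.real_smul]
    push_cast
    ring
  rw [h3]
  refine (enorm_integral_le_lintegral_enorm _).trans (le_of_eq ?_)
  simp only [enorm_mul]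

theorem schwartz_Lq (ψ : 𝓢(EuclideanSpace ℝ (Fin n), ℂ)) (q : ℝ) (hq : 0 < q) :
    ∫⁻ x, ‖ψ x‖ₑ ^ q ≠ ∞ := by
  have h := SchwartzMap.eLpNorm_lt_top ψ (ENNReal.ofReal q) volume
  rw [eLpNorm_lt_top_iff_lintegral_rpow_enorm_lt_top (by simpa using hq) ENNReal.ofReal_ne_top,
    ENNReal.toReal_ofReal hq.le] at h
  exact h.ne

theorem main_false (k ℓ : ℕ) (hn : 0 < n) (hl : ℓ < k) (A : (Fin n → ℕ) → (V →ₗ[ℝ] E))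
    (hell : ∀ ξ : EuclideanSpace ℝ (Fin n), ξ ≠ 0 → Function.Injective (symb k A ξ))
    (s p q C : ℝ) (hpq : p.HolderConjugate q) (hsk : s = (k : ℝ) - ℓ) (hs : ((n : ℝ) - s) * p = n)
    (hC : 0 < C)
    (hE : ∀ u : 𝓢(EuclideanSpace ℝ (Fin n), V),
      ∫⁻ x, ENNReal.ofReal (‖iteratedFDeriv ℝ ℓ u x‖ ^ p) ≤
        ENNReal.ofReal ((C * ∫ x, ‖opApply k A u x‖) ^ p))
    (e : E) (he0 : e ≠ 0)
    (a : EuclideanSpace ℝ (Fin n) → V)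
    (ha : ∀ ξ, ξ ≠ 0 → ContDiffAt ℝ (⊤ : ℕ∞) a ξ)
    (ha1 : ∀ ξ, ξ ≠ 0 → symb k A ξ (a ξ) = e)
    (ha2 : ∀ (t : ℝ) ξ, 0 < t → ξ ≠ 0 → a (t • ξ) = (t ^ k)⁻¹ • a ξ) : False := by
  obtain ⟨ξ0, hξ0⟩ : ∃ ξ0 : EuclideanSpace ℝ (Fin n), ξ0 ≠ 0 :=
    ⟨EuclideanSpace.single ⟨0, hn⟩ 1, by simp⟩
  set b := a ξ0 with hb
  have hb0 : b ≠ 0 := by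
    intro h
    have := ha1 ξ0 hξ0
    rw [← hb, h, map_zero] at this
    exact he0 this.symm
  have hN : 0 < ‖ξ0‖ := norm_pos_iff.2 hξ0
  obtain ⟨M, hM⟩ := exists_cutoff n
  let β : ContDiffBump ξ0 := ⟨‖ξ0‖ / 4, ‖ξ0‖ / 2, by positivity, by linarith⟩
  have hβ0 : ∀ ξ, β ξ ≠ 0 → ‖ξ0‖ / 2 ≤ ‖ξ‖ ∧ ‖ξ‖ ≤ 2 * ‖ξ0‖ := by
    intro ξ h
    have h1 : ξ ∈ Metric.ball ξ0 (‖ξ0‖ / 2) := by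
      have : ξ ∈ Function.support β := h
      rwa [β.support_eq] at this
    rw [mem_ball_iff_norm] at h1
    constructor
    · have := norm_sub_norm_le ξ0 ξ
      rw [norm_sub_rev] at this
      linarith
    · have := norm_sub_norm_le ξ ξ0
      linarith
  let m : EuclideanSpace ℝ (Fin n) → ℝ := fun ξ => inner ℝ ξ ξ0 ^ ℓ * inner ℝ b (a ξ)
  have hβ1 : (β : EuclideanSpace ℝ (Fin n) → ℝ) =ᶠ[𝓝 0] 0 := by
    have : {ξ : EuclideanSpace ℝ (Fin n) | ‖ξ‖ < ‖ξ0‖ / 2} ∈ 𝓝 0 := by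
      refine IsOpen.mem_nhds (isOpen_lt continuous_norm continuous_const) ?_
      simpa using hN
    filter_upwards [this] with ξ hξ
    by_contra h
    exact absurd (hβ0 ξ h).1 (not_le.2 hξ)
  -- products with cutoffs
  have hcut : ∀ φ : EuclideanSpace ℝ (Fin n) → ℝ, ContDiff ℝ (⊤ : ℕ∞) φ → φ =ᶠ[𝓝 0] 0 →
      ContDiff ℝ (⊤ : ℕ∞) (fun ξ => inner ℝ ξ ξ0 ^ ℓ * inner ℝ b (φ ξ • a ξ)) := by
    intro φ h1 h2
    have := contDiff_cut φ h1 h2 a ha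
    refine ContDiff.mul ?_ (contDiff_const.inner ℝ this)
    exact (contDiff_id.inner ℝ contDiff_const).pow _
  have hcutC : ∀ φ : EuclideanSpace ℝ (Fin n) → ℝ, ContDiff ℝ (⊤ : ℕ∞) φ → φ =ᶠ[𝓝 0] 0 →
      HasCompactSupport φ → ∃ f : 𝓢(EuclideanSpace ℝ (Fin n), ℂ),
        ∀ ξ, f ξ = ((inner ℝ ξ ξ0 ^ ℓ * inner ℝ b (φ ξ • a ξ) : ℝ) : ℂ) := by
    intro φ h1 h2 h3
    have hcs : HasCompactSupport
        (fun ξ => ((inner ℝ ξ ξ0 ^ ℓ * inner ℝ b (φ ξ • a ξ) : ℝ) : ℂ)) := by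
      refine h3.mono ?_
      intro ξ hξ
      rw [Function.mem_support] at hξ ⊢
      contrapose! hξ
      simp [hξ]
    exact ⟨hcs.toSchwartzMap (Complex.ofRealCLM.contDiff.comp (hcut φ h1 h2)), fun ξ => rfl⟩
  have hφm : ∀ (φ : EuclideanSpace ℝ (Fin n) → ℝ) ξ,
      inner ℝ ξ ξ0 ^ ℓ * inner ℝ b (φ ξ • a ξ) = φ ξ * m ξ := by
    intro φ ξ
    simp only [m, inner_smul_right]
    ring
  obtain ⟨ψ, hψ⟩ := hcutC β β.contDiff hβ1 β.hasCompactSupport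
  have hmt : ∀ (t : ℝ) ξ, 0 < t → ξ ≠ 0 → t ^ s * m (t • ξ) = m ξ := by
    intro t ξ ht hξ
    simp only [m]
    rw [ha2 t ξ ht hξ, inner_smul_left, inner_smul_right, hsk, Real.rpow_sub ht, Real.rpow_natCast,
      Real.rpow_natCast]
    simp only [conj_trivial]
    rw [mul_pow]
    field_simp
  let g : EuclideanSpace ℝ (Fin n) → ℝ := fun ξ => β ξ * m ξ ^ 2
  have hgc : Continuous g := by
    refine (contDiff_cut (V := ℝ) β β.contDiff hβ1 (fun ξ => m ξ ^ 2) fun ξ hξ => ?_).continuous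
    refine ContDiffAt.pow (ContDiffAt.mul ?_ (contDiffAt_const.inner ℝ (ha ξ hξ))) 2
    exact (contDiff_id.inner ℝ contDiff_const).contDiffAt.pow _
  have hgpos : 0 < ∫ ξ, g ξ := by
    refine hgc.integral_pos_of_hasCompactSupport_nonneg_nonzero (x := ξ0) ?_ ?_ ?_
    · exact β.hasCompactSupport.mul_right
    · intro ξ
      exact mul_nonneg β.nonneg (sq_nonneg _)
    · have h1 : β ξ0 = 1 := β.one_of_mem_closedBall (by simpa using β.rIn_pos.le)
      simp only [g, m, h1, ← hb, real_inner_self_eq_norm_sq]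
      have : 0 < ‖b‖ := norm_pos_iff.2 hb0
      positivity
  refine core_dilation s p q hpq hn hs ⇑(𝓕⁻ ψ : 𝓢(EuclideanSpace ℝ (Fin n), ℂ)) (SchwartzMap.continuous _).measurable
    (schwartz_Lq _ q hpq.symm.pos) 
    (2 ^ (p - 1) * ((ENNReal.ofReal ((‖b‖ * ‖ξ0‖ ^ ℓ) ^ p) * ENNReal.ofReal
        ((C * (‖(-(2 * Real.pi * Complex.I)) ^ k * ((-(2 * Real.pi * Complex.I)) ^ ℓ)⁻¹‖ * M * ‖e‖)) ^ p)) + (ENNReal.ofReal ((‖b‖ * ‖ξ0‖ ^ ℓ) ^ p) * ENNReal.ofReal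
        ((C * (‖(-(2 * Real.pi * Complex.I)) ^ k * ((-(2 * Real.pi * Complex.I)) ^ ℓ)⁻¹‖ * M * ‖e‖)) ^ p)))) ?_
    ‖∫ ξ, ((g ξ : ℝ) : ℂ)‖ₑ ?_ enorm_ne_top ?_
  · refine ENNReal.mul_ne_top (ENNReal.rpow_ne_top_of_nonneg (by linarith [hpq.lt]) (by simp)) ?_
    exact ENNReal.add_ne_top.2 ⟨ENNReal.mul_ne_top ENNReal.ofReal_ne_top ENNReal.ofReal_ne_top,
      ENNReal.mul_ne_top ENNReal.ofReal_ne_top ENNReal.ofReal_ne_top⟩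
  · rw [integral_complex_ofReal]
    simpa using hgpos.ne'
  · intro Λ hΛ
    obtain ⟨φ, hφ1, hφ2, hφ3, hφ4, hφ5⟩ := hM (1 + 4 / ‖ξ0‖ + Λ * (2 * ‖ξ0‖)) (by
      have : 0 ≤ 4 / ‖ξ0‖ + Λ * (2 * ‖ξ0‖) := by positivity
      linarith)
    obtain ⟨f, hf⟩ := hcutC φ hφ1 hφ3 hφ2
    have hφcs : HasCompactSupport (fun ξ => (φ ξ : ℂ)) := by
      refine hφ2.mono ?_
      intro ξ hξ
      rw [Function.mem_support] at hξ ⊢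
      contrapose! hξ
      simp [hξ]
    let φS : 𝓢(EuclideanSpace ℝ (Fin n), ℂ) :=
      hφcs.toSchwartzMap (Complex.ofRealCLM.contDiff.comp hφ1)
    have hφS : (⇑φS : EuclideanSpace ℝ (Fin n) → ℂ) = fun ξ => (φ ξ : ℂ) := rfl
    have hFcs : HasCompactSupport (fun ξ => φ ξ • a ξ) := hφ2.smul_right
    let F : 𝓢(EuclideanSpace ℝ (Fin n), V) := hFcs.toSchwartzMap (contDiff_cut φ hφ1 hφ3 a ha)
    have hF : ∀ ξ, F ξ = φ ξ • a ξ := fun ξ => rfl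
    refine ⟨⇑(𝓕 f : 𝓢(EuclideanSpace ℝ (Fin n), ℂ)), (SchwartzMap.continuous _).measurable, ?_, ?_⟩
    · refine upper_full _ (SchwartzMap.continuous _).measurable p hpq.lt.le _ fun c hc => ?_
      have key := upper_re k ℓ A p C M hpq.pos hC hE e φ (hφ1.continuous.integrable_of_hasCompactSupport hφ2)
        (by rw [← hφS, ← SchwartzMap.fourier_coe]; exact SchwartzMap.integrable _) hφ5 F (by
          intro ξ
          by_cases h : ξ = 0
          · subst h
            have : φ 0 = 0 := hφ3.eq_of_nhds
            simp [hF, this]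
          · rw [hF, map_smul, ha1 ξ h]) ξ0 b c hc
      rw [SchwartzMap.fourier_coe]
      have : (⇑f : EuclideanSpace ℝ (Fin n) → ℂ) =
        fun ξ => ((inner ℝ ξ ξ0 ^ ℓ * inner ℝ b (F ξ) : ℝ) : ℂ) := funext hf
      rw [this]
      exact key
    · intro t ht1 ht2
      have ht : 0 < t := by linarith
      refine pairing f ψ s t ht _ fun ξ => ?_
      rw [hf, hψ, hφm, hφm]
      by_cases h : β ξ = 0
      · simp [g, h]
      obtain ⟨h1, h2⟩ := hβ0 ξ h
      have hξ : ξ ≠ 0 := by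
        rintro rfl
        rw [norm_zero] at h1
        linarith
      have h3 : φ (t • ξ) = 1 := by
        apply hφ4
        · rw [norm_smul, Real.norm_of_nonneg ht.le, div_le_iff₀ (by positivity)]
          have e1 : ‖ξ0‖ / 2 ≤ t * ‖ξ‖ := by nlinarith [norm_nonneg ξ]
          have e2 : 4 / ‖ξ0‖ ≤ 1 + 4 / ‖ξ0‖ + Λ * (2 * ‖ξ0‖) := by
            have : 0 ≤ Λ * (2 * ‖ξ0‖) := by positivity
            linarith
          calc (2 : ℝ) = (‖ξ0‖ / 2) * (4 / ‖ξ0‖) := by field_simp; norm_num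
            _ ≤ _ := by gcongr
        · rw [norm_smul, Real.norm_of_nonneg ht.le]
          have : t * ‖ξ‖ ≤ Λ * (2 * ‖ξ0‖) := by gcongr
          have : 0 ≤ 4 / ‖ξ0‖ := by positivity
          linarith
      rw [h3, ← Complex.ofReal_mul, ← Complex.ofReal_mul]
      congr 1
      have := hmt t ξ ht hξ
      simp only [g]
      calc _ = (t ^ s * m (t • ξ)) * (β ξ * m ξ) := by ring
        _ = _ := by rw [this]; ring
end L5


/-- Necessity of cancellation: if `A(D)` is injectively elliptic and the endpoint
Sobolev inequality holds, then `A(D)` is cancelling. -/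
theorem stmt5
    {V E : Type*} [NormedAddCommGroup V] [InnerProductSpace ℝ V] [FiniteDimensional ℝ V]
    [NormedAddCommGroup E] [InnerProductSpace ℝ E] [FiniteDimensional ℝ E]
    (n k ℓ : ℕ) (hn : 2 ≤ n) (hk : 1 ≤ k) (hl : ℓ < k) (hkl : k - ℓ < n)
    (A : (Fin n → ℕ) → (V →ₗ[ℝ] E))
    (hell : ∀ ξ : EuclideanSpace ℝ (Fin n), ξ ≠ 0 → Function.Injective (symb k A ξ))
    (hest : ∃ C : ℝ, 0 < C ∧ ∀ u : EuclideanSpace ℝ (Fin n) → V,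
      ContDiff ℝ (⊤ : ℕ∞) u → HasCompactSupport u →
      (∫ x, ‖iteratedFDeriv ℝ ℓ u x‖ ^ ((n : ℝ) / ((n : ℝ) - ((k - ℓ : ℕ) : ℝ))))
          ^ (1 - ((k - ℓ : ℕ) : ℝ) / (n : ℝ))
        ≤ C * ∫ x, ‖opApply k A u x‖) :
    (⋂ ξ ∈ {ξ : EuclideanSpace ℝ (Fin n) | ξ ≠ 0},
        (LinearMap.range (symb k A ξ) : Set E)) = {0} := by
  obtain ⟨C, hC, hest⟩ := hest
  ext e
  simp only [Set.mem_iInter, Set.mem_setOf_eq, SetLike.mem_coe, Set.mem_singleton_iff]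
  constructor
  swap
  · rintro rfl ξ _
    exact zero_mem _
  intro he
  by_contra he0
  obtain ⟨a, ha, ha1, ha2⟩ := exists_a k A hell e he
  have hs0 : (0 : ℝ) < ((k - ℓ : ℕ) : ℝ) := by exact_mod_cast Nat.sub_pos_of_lt hl
  have hsn : ((k - ℓ : ℕ) : ℝ) < n := by exact_mod_cast hkl
  have hsk : ((k - ℓ : ℕ) : ℝ) = (k : ℝ) - ℓ := Nat.cast_sub hl.le
  generalize ((k - ℓ : ℕ) : ℝ) = s at *
  have hn0 : (0 : ℝ) < n := hs0.trans hsn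
  have hd : 0 < (n : ℝ) - s := sub_pos.2 hsn
  have hpq : ((n : ℝ) / (n - s)).HolderConjugate (n / s) := by
    rw [Real.holderConjugate_iff]
    refine ⟨by rw [lt_div_iff₀ hd]; linarith, ?_⟩
    field_simp
    ring
  refine main_false k ℓ (by omega) hl A hell s _ _ C hpq hsk (by field_simp) hC ?_ e he0 a ha ha1 ha2
  refine est_schwartz k ℓ A _ _ C hpq.pos ?_ hest
  field_simp

end
end

section
/- There is no constant C ∈ (0,∞) such that for every u ∈ C^∞_c(ℝ³, ℝ³) one has (∫_{ℝ³} |u|^{3/2})^{2/3} ≤ C ∫_{ℝ³} (|div u| + |curl u|), where div u = ∂₁u¹ + ∂₂u² + ∂₃u³ and curl u is the vector field with components (∂₂u³ − ∂₃u², ∂₃u¹ − ∂₁u³, ∂₁u² − ∂₂u¹). -/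
open MeasureTheory

noncomputable section

/-- The divergence of a vector field on `ℝ³`. -/
def div3 (u : EuclideanSpace ℝ (Fin 3) → EuclideanSpace ℝ (Fin 3)) :
    EuclideanSpace ℝ (Fin 3) → ℝ :=
  fun x => ∑ i, fderiv ℝ u x (EuclideanSpace.single i 1) i

/-- Partial derivative `∂ᵢ u^j` of a vector field on `ℝ³`. -/
def pdc (i j : Fin 3) (u : EuclideanSpace ℝ (Fin 3) → EuclideanSpace ℝ (Fin 3)) :
    EuclideanSpace ℝ (Fin 3) → ℝ :=
  fun x => fderiv ℝ u x (EuclideanSpace.single i 1) j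

/-- The curl of a vector field on `ℝ³`:
`curl u = (∂₂u³ − ∂₃u², ∂₃u¹ − ∂₁u³, ∂₁u² − ∂₂u¹)`. -/
def curl3 (u : EuclideanSpace ℝ (Fin 3) → EuclideanSpace ℝ (Fin 3)) :
    EuclideanSpace ℝ (Fin 3) → EuclideanSpace ℝ (Fin 3) :=
  fun x => (WithLp.equiv 2 (Fin 3 → ℝ)).symm
    ![pdc 1 2 u x - pdc 2 1 u x, pdc 2 0 u x - pdc 0 2 u x, pdc 0 1 u x - pdc 1 0 u x]


/-- The cutoff. -/
def etaB : ContDiffBump (0 : (EuclideanSpace ℝ (Fin 3))) := ⟨1, 2, one_pos, one_lt_two⟩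

/-- The radial weight. -/
def gW (x : (EuclideanSpace ℝ (Fin 3))) : ℝ := (1 + ‖x‖ ^ 2) ^ (-3 / 2 : ℝ)

def hW (x : (EuclideanSpace ℝ (Fin 3))) : ℝ := (1 + ‖x‖ ^ 2) ^ (-5 / 2 : ℝ)

def phiR (R : ℝ) (x : (EuclideanSpace ℝ (Fin 3))) : ℝ := etaB (R⁻¹ • x)

def uR (R : ℝ) (x : (EuclideanSpace ℝ (Fin 3))) : (EuclideanSpace ℝ (Fin 3)) := (phiR R x * gW x) • x

lemma gW_pos (x : (EuclideanSpace ℝ (Fin 3))) : 0 < gW x := by unfold gW; positivity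
lemma hW_pos (x : (EuclideanSpace ℝ (Fin 3))) : 0 < hW x := by unfold hW; positivity

lemma gW_eq (x : (EuclideanSpace ℝ (Fin 3))) : gW x = hW x * (1 + ‖x‖ ^ 2) := by
  have h : (0 : ℝ) < 1 + ‖x‖ ^ 2 := by positivity
  unfold gW hW
  rw [← Real.rpow_add_one h.ne']
  norm_num

lemma gW_contDiff : ContDiff ℝ (⊤ : ℕ∞) gW := by
  unfold gW
  apply ContDiff.rpow_const_of_ne
  · exact contDiff_const.add (contDiff_id.norm_sq ℝ)
  · intro x; positivity

lemma gW_hasFDerivAt (x : (EuclideanSpace ℝ (Fin 3))) :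
    HasFDerivAt gW ((-3 * hW x) • (innerSL ℝ x : (EuclideanSpace ℝ (Fin 3)) →L[ℝ] ℝ)) x := by
  have h1 : HasFDerivAt (fun y : (EuclideanSpace ℝ (Fin 3)) => 1 + ‖y‖ ^ 2) (2 • (innerSL ℝ x : (EuclideanSpace ℝ (Fin 3)) →L[ℝ] ℝ)) x :=
    (hasStrictFDerivAt_norm_sq x).hasFDerivAt.const_add 1
  have h2 := h1.rpow_const (p := (-3 / 2 : ℝ)) (Or.inl (by positivity))
  refine h2.congr_fderiv ?_
  ext v
  simp [hW]
  norm_num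
  ring

lemma phiR_contDiff (R : ℝ) : ContDiff ℝ (⊤ : ℕ∞) (phiR R) := by
  unfold phiR
  exact etaB.contDiff.comp (contDiff_const_smul _)

lemma phiR_hasFDerivAt (R : ℝ) (x : (EuclideanSpace ℝ (Fin 3))) :
    HasFDerivAt (phiR R) (R⁻¹ • fderiv ℝ etaB (R⁻¹ • x)) x := by
  have h1 : HasFDerivAt etaB (fderiv ℝ etaB (R⁻¹ • x)) (R⁻¹ • x) :=
    ((etaB.contDiff (n := 1)).differentiable (by norm_num) _).hasFDerivAt
  have h2 : HasFDerivAt (fun y : (EuclideanSpace ℝ (Fin 3)) => R⁻¹ • y) (R⁻¹ • ContinuousLinearMap.id ℝ (EuclideanSpace ℝ (Fin 3))) x :=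
    (R⁻¹ • ContinuousLinearMap.id ℝ (EuclideanSpace ℝ (Fin 3))).hasFDerivAt
  refine (h1.comp x h2).congr_fderiv ?_
  ext v
  simp

lemma uR_contDiff (R : ℝ) : ContDiff ℝ (⊤ : ℕ∞) (uR R) :=
  ((phiR_contDiff R).mul gW_contDiff).smul contDiff_id

lemma uR_support {R : ℝ} (hR : 0 < R) : HasCompactSupport (uR R) := by
  have h : HasCompactSupport (phiR R) :=
    etaB.hasCompactSupport.comp_smul (inv_ne_zero hR.ne')
  exact (h.mul_right (f' := gW)).smul_right (f' := fun x : (EuclideanSpace ℝ (Fin 3)) => x)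

lemma uR_fderiv (R : ℝ) (x v : (EuclideanSpace ℝ (Fin 3))) (j : Fin 3) :
    fderiv ℝ (uR R) x v j = phiR R x * gW x * v j
      + (gW x * (R⁻¹ * fderiv ℝ etaB (R⁻¹ • x) v)
        + phiR R x * (-3 * hW x * inner ℝ x v)) * x j := by
  have h := (((phiR_hasFDerivAt R x).mul (gW_hasFDerivAt x)).smul (hasFDerivAt_id x)).fderiv
  have h' : fderiv ℝ (uR R) x = _ := h
  rw [h']
  simp only [add_apply, smul_apply, ContinuousLinearMap.smulRight_apply, Pi.mul_apply, id,
    ContinuousLinearMap.id_apply, innerSL_apply_apply, PiLp.add_apply, PiLp.smul_apply, smul_eq_mul]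
  ring

lemma expand (L : (EuclideanSpace ℝ (Fin 3)) →L[ℝ] ℝ) (x : (EuclideanSpace ℝ (Fin 3))) :
    L x = L (EuclideanSpace.single 0 1) * x 0 + L (EuclideanSpace.single 1 1) * x 1
      + L (EuclideanSpace.single 2 1) * x 2 := by
  have : x = x 0 • EuclideanSpace.single 0 1 + x 1 • EuclideanSpace.single 1 1
      + x 2 • (EuclideanSpace.single 2 1 : (EuclideanSpace ℝ (Fin 3))) := by
    ext i; fin_cases i <;> simp
  conv_lhs => rw [this]
  simp only [map_add, map_smul, smul_eq_mul]
  ring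

lemma uR_div (R : ℝ) (x : (EuclideanSpace ℝ (Fin 3))) :
    div3 (uR R) x = 3 * phiR R x * hW x + gW x * (R⁻¹ * fderiv ℝ etaB (R⁻¹ • x) x) := by
  unfold div3
  rw [expand (fderiv ℝ etaB (R⁻¹ • x)) x]
  simp only [Fin.sum_univ_three, uR_fderiv]
  have hn : ‖x‖ ^ 2 = x 0 ^ 2 + x 1 ^ 2 + x 2 ^ 2 := by
    rw [EuclideanSpace.norm_sq_eq]; simp [Fin.sum_univ_three]
  have := gW_eq x
  rw [hn] at this
  simp [EuclideanSpace.inner_single_right]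
  linear_combination 3 * phiR R x * this

lemma uR_pdc (R : ℝ) (x : (EuclideanSpace ℝ (Fin 3))) (i j : Fin 3) :
    pdc i j (uR R) x - pdc j i (uR R) x
      = gW x * R⁻¹ * (fderiv ℝ etaB (R⁻¹ • x) (EuclideanSpace.single i 1) * x j
        - fderiv ℝ etaB (R⁻¹ • x) (EuclideanSpace.single j 1) * x i) := by
  unfold pdc
  simp only [uR_fderiv]
  rcases eq_or_ne i j with rfl | h
  · simp
  · simp [EuclideanSpace.inner_single_right, h, h.symm]
    ring

/-- The error term. -/
def errT (R : ℝ) (x : (EuclideanSpace ℝ (Fin 3))) : ℝ := gW x * R⁻¹ * (‖fderiv ℝ etaB (R⁻¹ • x)‖ * ‖x‖)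

lemma uR_pdc_le {R : ℝ} (hR : 0 < R) (x : (EuclideanSpace ℝ (Fin 3))) (i j : Fin 3) :
    |pdc i j (uR R) x - pdc j i (uR R) x| ≤ 2 * errT R x := by
  have key : ∀ i j : Fin 3, |fderiv ℝ etaB (R⁻¹ • x) (EuclideanSpace.single i 1) * x j|
      ≤ ‖fderiv ℝ etaB (R⁻¹ • x)‖ * ‖x‖ := by
    intro i j
    rw [abs_mul]
    have h1 := (fderiv ℝ etaB (R⁻¹ • x)).le_opNorm (EuclideanSpace.single i 1)
    have h2 := PiLp.norm_apply_le x j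
    simp at h1 h2
    gcongr
  have hg : 0 < gW x * R⁻¹ := mul_pos (gW_pos x) (inv_pos.2 hR)
  rw [uR_pdc, abs_mul, abs_of_pos hg, errT]
  have := abs_sub (fderiv ℝ etaB (R⁻¹ • x) (EuclideanSpace.single i 1) * x j)
    (fderiv ℝ etaB (R⁻¹ • x) (EuclideanSpace.single j 1) * x i)
  nlinarith [key i j, key j i]

lemma norm_le3 (a b c : ℝ) :
    ‖((WithLp.equiv 2 (Fin 3 → ℝ)).symm ![a, b, c] : (EuclideanSpace ℝ (Fin 3)))‖ ≤ |a| + |b| + |c| := by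
  rw [EuclideanSpace.norm_eq]
  apply Real.sqrt_le_iff.2 ⟨by positivity, ?_⟩
  simp [Fin.sum_univ_three]
  rw [← sq_abs a, ← sq_abs b, ← sq_abs c]
  nlinarith [mul_nonneg (abs_nonneg a) (abs_nonneg b), mul_nonneg (abs_nonneg a) (abs_nonneg c),
    mul_nonneg (abs_nonneg b) (abs_nonneg c)]

lemma integrand_le {R : ℝ} (hR : 0 < R) (x : (EuclideanSpace ℝ (Fin 3))) :
    |div3 (uR R) x| + ‖curl3 (uR R) x‖ ≤ 3 * hW x + 7 * errT R x := by
  have hc : ‖curl3 (uR R) x‖ ≤ 6 * errT R x := by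
    refine (norm_le3 _ _ _).trans ?_
    linarith [uR_pdc_le hR x 1 2, uR_pdc_le hR x 2 0, uR_pdc_le hR x 0 1]
  have hd : |div3 (uR R) x| ≤ 3 * hW x + errT R x := by
    rw [uR_div]
    refine (abs_add_le _ _).trans ?_
    have h0 : 0 ≤ phiR R x := etaB.nonneg
    have h1 : phiR R x ≤ 1 := etaB.le_one
    have h2 := hW_pos x
    rw [abs_of_nonneg (by positivity : 0 ≤ 3 * phiR R x * hW x)]
    have hg : 0 < gW x * R⁻¹ := mul_pos (gW_pos x) (inv_pos.2 hR)
    rw [← mul_assoc (gW x), abs_mul, abs_of_pos hg, errT]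
    have := (fderiv ℝ etaB (R⁻¹ • x)).le_opNorm x
    rw [Real.norm_eq_abs] at this
    gcongr
    nlinarith
  linarith

lemma exists_bound : ∃ M : ℝ, 0 ≤ M ∧ ∀ y, ‖fderiv ℝ etaB y‖ ≤ M := by
  have hc : Continuous (fderiv ℝ etaB) :=
    (etaB.contDiff (n := 1)).continuous_fderiv (by norm_num)
  obtain ⟨M, hM⟩ := hc.bounded_above_of_compact_support (etaB.hasCompactSupport.fderiv ℝ)
  exact ⟨M, (norm_nonneg _).trans (hM 0), hM⟩

lemma fderiv_eta_zero_in {y : (EuclideanSpace ℝ (Fin 3))} (hy : ‖y‖ < 1) : fderiv ℝ etaB y = 0 := by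
  have h : etaB =ᶠ[nhds y] 1 :=
    etaB.eventuallyEq_one_of_mem_ball (by simpa [etaB] using hy)
  rw [h.fderiv_eq]
  simp

lemma fderiv_eta_zero_out {y : (EuclideanSpace ℝ (Fin 3))} (hy : 2 < ‖y‖) : fderiv ℝ etaB y = 0 := by
  by_contra h
  have h1 : y ∈ tsupport (fderiv ℝ etaB) := subset_tsupport _ h
  have h2 := tsupport_fderiv_subset ℝ h1
  rw [etaB.tsupport_eq] at h2
  simp [etaB] at h2
  linarith

lemma errT_le {M : ℝ} (hM0 : 0 ≤ M) (hM : ∀ y, ‖fderiv ℝ etaB y‖ ≤ M) {R : ℝ} (hR : 0 < R)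
    (x : (EuclideanSpace ℝ (Fin 3))) : errT R x ≤ (R ^ 3)⁻¹ *
      (Metric.closedBall (0 : (EuclideanSpace ℝ (Fin 3))) 2).indicator (fun _ => 2 * M) (R⁻¹ • x) := by
  have hr : 0 ≤ (R ^ 3)⁻¹ *
      (Metric.closedBall (0 : (EuclideanSpace ℝ (Fin 3))) 2).indicator (fun _ => 2 * M) (R⁻¹ • x) :=
    mul_nonneg (by positivity) (Set.indicator_nonneg (fun _ _ => by positivity) _)
  have hn : ‖x‖ = R * ‖R⁻¹ • x‖ := by
    rw [norm_smul, Real.norm_of_nonneg (by positivity)]; field_simp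
  rcases lt_or_ge ‖R⁻¹ • x‖ 1 with h1 | h1
  · simpa [errT, fderiv_eta_zero_in h1] using hr
  rcases lt_or_ge 2 ‖R⁻¹ • x‖ with h2 | h2
  · simpa [errT, fderiv_eta_zero_out h2] using hr
  rw [Set.indicator_of_mem (by simpa using h2)]
  have hx1 : R ≤ ‖x‖ := by rw [hn]; nlinarith
  have hx2 : ‖x‖ ≤ R * 2 := by rw [hn]; nlinarith
  have hg : gW x ≤ (R ^ 3)⁻¹ := by
    have : gW x ≤ (R ^ 2) ^ (-3 / 2 : ℝ) := by
      apply Real.rpow_le_rpow_of_nonpos (by positivity) _ (by norm_num)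
      nlinarith
    refine this.trans (le_of_eq ?_)
    rw [← Real.rpow_natCast, ← Real.rpow_mul hR.le, ← Real.rpow_natCast, ← Real.rpow_neg hR.le]
    norm_num
  unfold errT
  calc gW x * R⁻¹ * (‖fderiv ℝ etaB (R⁻¹ • x)‖ * ‖x‖)
      ≤ (R ^ 3)⁻¹ * R⁻¹ * (M * (R * 2)) := by
        gcongr
        exact hM _
    _ = _ := by field_simp

lemma hW_integrable : Integrable hW := by
  have := integrable_rpow_neg_one_add_norm_sq (E := (EuclideanSpace ℝ (Fin 3))) (μ := volume) (r := 5)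
    (by simp; norm_num)
  exact this

lemma rhs_bounded : ∃ K : ℝ, ∀ R : ℝ, 0 < R →
    ∫ x, (|div3 (uR R) x| + ‖curl3 (uR R) x‖) ≤ K := by
  obtain ⟨M, hM0, hM⟩ := exists_bound
  set I : (EuclideanSpace ℝ (Fin 3)) → ℝ := (Metric.closedBall (0 : (EuclideanSpace ℝ (Fin 3))) 2).indicator (fun _ => 2 * M) with hI
  have hIi : Integrable I := by
    rw [hI, integrable_indicator_iff Metric.isClosed_closedBall.measurableSet]
    exact integrableOn_const (isCompact_closedBall _ _).measure_lt_top.ne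
  refine ⟨3 * (∫ x, hW x) + 7 * ∫ x, I x, fun R hR => ?_⟩
  have hi1 : Integrable (fun x => 3 * hW x) := hW_integrable.const_mul 3
  have hi2 : Integrable (fun x => 7 * ((R ^ 3)⁻¹ * I (R⁻¹ • x))) :=
    ((hIi.comp_smul (inv_ne_zero hR.ne')).const_mul _).const_mul _
  calc ∫ x, (|div3 (uR R) x| + ‖curl3 (uR R) x‖)
      ≤ ∫ x, (3 * hW x + 7 * ((R ^ 3)⁻¹ * I (R⁻¹ • x))) := by
        apply integral_mono_of_nonneg
        · exact Filter.Eventually.of_forall fun x => by positivity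
        · exact hi1.add hi2
        · refine Filter.Eventually.of_forall fun x => ?_
          have h1 := integrand_le hR x
          have h2 := errT_le hM0 hM hR x
          simp only
          linarith
    _ = _ := by
        rw [integral_add hi1 hi2, integral_const_mul, integral_const_mul, integral_const_mul,
          Measure.integral_comp_inv_smul_of_nonneg _ _ hR.le]
        simp
        field_simp

/-- The radial profile of the limit field, to the power 3/2. -/
def prof (y : ℝ) : ℝ := (y * (1 + y ^ 2) ^ (-3 / 2 : ℝ)) ^ ((3 : ℝ) / 2)

lemma prof_not_integrable : ¬ Integrable (fun x : (EuclideanSpace ℝ (Fin 3)) => prof ‖x‖) := by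
  intro h
  rw [integrable_fun_norm_addHaar] at h
  have h1 : IntegrableOn (fun y : ℝ => y ^ 2 * prof y) (Set.Ioi 1) := by
    have := h.mono_set (Set.Ioi_subset_Ioi zero_le_one)
    simpa using this
  have h2 := h1.const_mul ((2 : ℝ) ^ (9 / 4 : ℝ))
  apply not_integrableOn_Ioi_inv (a := 1)
  refine Integrable.mono' h2 (by fun_prop) ?_
  filter_upwards [ae_restrict_mem measurableSet_Ioi] with y hy
  have hy1 : (1 : ℝ) < y := hy
  have hy0 : 0 < y := by linarith
  rw [Real.norm_of_nonneg (by positivity)]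
  have h3 : (2 * y ^ 2) ^ (-3 / 2 : ℝ) ≤ (1 + y ^ 2) ^ (-3 / 2 : ℝ) := by
    apply Real.rpow_le_rpow_of_nonpos (by positivity) _ (by norm_num)
    nlinarith
  have h4 : (y * (2 * y ^ 2) ^ (-3 / 2 : ℝ)) ^ ((3 : ℝ) / 2) ≤ prof y := by
    unfold prof
    gcongr
  have h5 : (y * (2 * y ^ 2) ^ (-3 / 2 : ℝ)) ^ ((3 : ℝ) / 2)
      = (2 : ℝ) ^ (-9 / 4 : ℝ) * y ^ (-3 : ℝ) := by
    rw [Real.mul_rpow (by positivity) (by positivity), ← Real.rpow_natCast,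
      Real.mul_rpow (by positivity) (by positivity),
      Real.mul_rpow (by positivity) (by positivity), ← Real.rpow_mul (by positivity),
      ← Real.rpow_mul (by positivity), ← Real.rpow_mul (by positivity), mul_left_comm,
      ← Real.rpow_add hy0]
    norm_num
  calc y⁻¹ = (2 : ℝ) ^ (9 / 4 : ℝ) * (y ^ 2 * ((2 : ℝ) ^ (-9 / 4 : ℝ) * y ^ (-3 : ℝ))) := by
        have : (2 : ℝ) ^ (9 / 4 : ℝ) * (2 : ℝ) ^ (-9 / 4 : ℝ) = 1 := by
          rw [← Real.rpow_add two_pos]; norm_num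
        have h6 : y ^ 2 * y ^ (-3 : ℝ) = y⁻¹ := by
          rw [← Real.rpow_natCast, ← Real.rpow_add hy0, ← Real.rpow_neg_one]; norm_num
        rw [← h6]
        linear_combination (-(y ^ 2 * y ^ (-3 : ℝ))) * this
    _ ≤ _ := by
        rw [← h5]
        gcongr

lemma prof_cont : Continuous (fun x : (EuclideanSpace ℝ (Fin 3)) => prof ‖x‖) := by
  unfold prof
  refine Continuous.rpow_const ?_ (fun _ => Or.inr (by norm_num))
  refine continuous_norm.mul (Continuous.rpow_const (by fun_prop) (fun x => Or.inl ?_))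
  positivity

lemma prof_nonneg (x : (EuclideanSpace ℝ (Fin 3))) : 0 ≤ prof ‖x‖ := by unfold prof; positivity

lemma lhs_ge {R : ℝ} (hR : 0 < R) :
    ∫ x in Metric.ball (0 : (EuclideanSpace ℝ (Fin 3))) R, prof ‖x‖ ≤ ∫ x, ‖uR R x‖ ^ ((3 : ℝ) / 2) := by
  rw [← integral_indicator Metric.isOpen_ball.measurableSet]
  apply integral_mono_of_nonneg
  · exact Filter.Eventually.of_forall fun x => Set.indicator_nonneg (fun x _ => prof_nonneg x) _
  · apply Continuous.integrable_of_hasCompactSupport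
    · exact (uR_contDiff R).continuous.norm.rpow_const (fun _ => Or.inr (by norm_num))
    · exact (uR_support hR).comp_left (g := fun v : (EuclideanSpace ℝ (Fin 3)) => ‖v‖ ^ ((3 : ℝ) / 2))
        (by simp)
  · refine Filter.Eventually.of_forall fun x => ?_
    simp only
    by_cases hx : x ∈ Metric.ball (0 : (EuclideanSpace ℝ (Fin 3))) R
    · rw [Set.indicator_of_mem hx]
      have hphi : phiR R x = 1 := by
        apply etaB.one_of_mem_closedBall
        have : ‖x‖ < R := by simpa using hx
        simp [etaB, norm_smul, abs_of_pos hR]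
        rw [inv_mul_le_iff₀ hR]; linarith
      rw [uR, hphi, one_mul, norm_smul, Real.norm_of_nonneg (gW_pos x).le, prof, mul_comm]
      rfl
    · rw [Set.indicator_of_notMem hx]; positivity

/-- There is no constant `C > 0` such that the endpoint Hodge–Sobolev inequality
`(∫ |u|^{3/2})^{2/3} ≤ C ∫ (|div u| + |curl u|)` holds for all `u ∈ C^∞_c(ℝ³, ℝ³)`. -/
theorem stmt6 :
    ¬ ∃ C : ℝ, 0 < C ∧ ∀ u : EuclideanSpace ℝ (Fin 3) → EuclideanSpace ℝ (Fin 3),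
      ContDiff ℝ (⊤ : ℕ∞) u → HasCompactSupport u →
      (∫ x, ‖u x‖ ^ ((3 : ℝ) / 2)) ^ ((2 : ℝ) / 3)
        ≤ C * ∫ x, (|div3 u x| + ‖curl3 u x‖) := by
  rintro ⟨C, hC, H⟩
  obtain ⟨K, hK⟩ := rhs_bounded
  apply prof_not_integrable
  have hb : ∀ R : ℝ, 0 < R →
      ∫ x in Metric.ball (0 : EuclideanSpace ℝ (Fin 3)) R, prof ‖x‖
        ≤ (C * K) ^ ((3 : ℝ) / 2) := by
    intro R hR
    refine (lhs_ge hR).trans ?_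
    have h1 := (H (uR R) (uR_contDiff R) (uR_support hR)).trans
      (mul_le_mul_of_nonneg_left (hK R hR) hC.le)
    have h0 : 0 ≤ ∫ x, ‖uR R x‖ ^ ((3 : ℝ) / 2) := integral_nonneg fun x => by positivity
    have h2 := Real.rpow_le_rpow (by positivity) h1 (by norm_num : (0 : ℝ) ≤ 3 / 2)
    rw [← Real.rpow_mul h0] at h2
    norm_num at h2 ⊢
    exact h2
  refine (aecover_ball (μ := volume) (x := (0 : EuclideanSpace ℝ (Fin 3)))
    (tendsto_natCast_atTop_atTop (R := ℝ))).integrable_of_integral_bounded_of_nonneg_ae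
    ((C * K) ^ ((3 : ℝ) / 2)) (fun n => ?_)
    (Filter.Eventually.of_forall prof_nonneg) ?_
  · exact (prof_cont.continuousOn.integrableOn_compact (isCompact_closedBall _ _)).mono_set
      Metric.ball_subset_closedBall
  · filter_upwards [Filter.eventually_gt_atTop 0] with n hn
    exact hb n (by exact_mod_cast hn)

end
end
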